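/- Let f ∈ C_0(ℝ^d), F(γ) := e^{⟨f,γ⟩}, and ε > 0. Then ∫_Γ (H_0^− F)(γ)(H_ε^− F)(γ) μ(dγ) = ∫_{ℝ^d} z dx ∫_{ℝ^d} dy (e^{f(x)}−1)² a(y) ∫_Γ exp[(2s−1)E(x,γ) + (s−1)E(y/ε + x, γ) + ⟨2f,γ⟩] μ(dγ) + ∫_{ℝ^d} z dx_1 ∫_{ℝ^d} z dx_2 ∫_{ℝ^d} dy (e^{f(x_1)}−1)(e^{f(x_2)}−1) e^{f(x_1)} e^{f(x_2)} a(y) exp[(2s−1)φ(x_1−x_2) + (s−1)φ(y/ε + x_1 − x_2)] ∫_Γ exp[(s−1)E(x_1,γ) + (s−1)E(x_2,γ) + (s−1)E(y/ε + x_1, γ) + ⟨2f,γ⟩] μ(dγ). -/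

import Mathlib

open MeasureTheory Set Filter
open scoped ENNReal NNReal BigOperators Topology Classical

noncomputable section

abbrev EucSp (d : ℕ) := EuclideanSpace ℝ (Fin d)

/-- The configuration space `Γ` over `ℝ^d`: locally finite subsets. -/
def Config (d : ℕ) : Type :=
  {γ : Set (EucSp d) // ∀ Λ : Set (EucSp d), IsCompact Λ → (γ ∩ Λ).Finite}

/-- The σ-algebra on `Γ` generated by the maps `γ ↦ |γ ∩ B|`, `B` Borel. -/
instance Config.instMS (d : ℕ) : MeasurableSpace (Config d) :=
  ⨆ (B : Set (EucSp d)) (_ : MeasurableSet B),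
    MeasurableSpace.comap (fun γ : Config d => (γ.1 ∩ B).encard) (⊤ : MeasurableSpace ℕ∞)

/-- `γ ∪ {x}`. -/
def Config.ins {d : ℕ} (γ : Config d) (x : EucSp d) : Config d :=
  ⟨insert x γ.1, fun Λ hΛ => ((γ.2 Λ hΛ).insert x).subset fun y hy => by
    rcases hy with ⟨h1, h2⟩
    rcases h1 with rfl | h1
    · exact Set.mem_insert _ _
    · exact Set.mem_insert_of_mem _ ⟨h1, h2⟩⟩

/-- `γ ∖ {x}`. -/
def Config.del {d : ℕ} (γ : Config d) (x : EucSp d) : Config d :=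
  ⟨γ.1 \ {x}, fun Λ hΛ => (γ.2 Λ hΛ).subset fun y hy => ⟨hy.1.1, hy.2⟩⟩

/-- The pairing `⟨f, γ⟩ = ∑_{x ∈ γ} f x`. -/
def cpair {d : ℕ} (f : EucSp d → ℝ) (γ : Config d) : ℝ := ∑' x : γ.1, f x.1

/-- `exp : [-∞,∞] → [0,∞]`. -/
def eexp (x : EReal) : ℝ≥0∞ :=
  if x = ⊤ then ⊤ else if x = ⊥ then 0 else ENNReal.ofReal (Real.exp x.toReal)

/-- real-valued exponential of an extended real (with `exp(±∞)` sent to junk value `0`). -/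
def rexp (x : EReal) : ℝ := (eexp x).toReal

/-- The relative energy `E(x,γ) = ∑_{y ∈ γ} φ(x-y)` if absolutely convergent, `+∞` otherwise. -/
def energy {d : ℕ} (φ : EucSp d → EReal) (x : EucSp d) (γ : Set (EucSp d)) : EReal :=
  if (∀ y ∈ γ, φ (x - y) ≠ ⊤) ∧ Summable (fun y : γ => (φ (x - y.1)).toReal)
  then (((∑' y : γ, (φ (x - y.1)).toReal) : ℝ) : EReal)
  else ⊤

/-- `∑_{u ∈ γ} φ(u)` if absolutely convergent, `+∞` otherwise. -/
def totPhi {d : ℕ} (φ : EucSp d → EReal) (γ : Set (EucSp d)) : EReal :=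
  if (∀ y ∈ γ, φ y ≠ ⊤) ∧ Summable (fun y : γ => (φ y.1).toReal)
  then (((∑' y : γ, (φ y.1).toReal) : ℝ) : EReal)
  else ⊤

/-- A pair potential: Borel, even, with `φ(x) ∈ ℝ` off the origin. -/
structure IsPairPotential {d : ℕ} (φ : EucSp d → EReal) : Prop where
  meas : Measurable φ
  even : ∀ x : EucSp d, x ≠ 0 → φ (-x) = φ x
  finite_off : ∀ x : EucSp d, x ≠ 0 → φ x ≠ ⊤
  ne_bot : ∀ x, φ x ≠ ⊥

/-- Stability (S): `∑_{{x,y} ⊆ η} φ(x-y) ≥ -B|η|` for all finite `η`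
(stated with the sum over ordered pairs, which doubles both sides). -/
def Stable {d : ℕ} (φ : EucSp d → EReal) (B : ℝ) : Prop :=
  ∀ η : Finset (EucSp d),
    ((-(2 * B * η.card) : ℝ) : EReal) ≤ ∑ p ∈ η.offDiag, φ (p.1 - p.2)

/-- Low activity–high temperature (LA-HT): `∫ |e^{-φ} - 1| z dx < (2 e^{1+2B})⁻¹`. -/
def LAHT {d : ℕ} (φ : EucSp d → EReal) (z B : ℝ) : Prop :=
  ∫⁻ x : EucSp d, ENNReal.ofReal (|rexp (-(φ x)) - 1| * z)
    < ENNReal.ofReal (2 * Real.exp (1 + 2 * B))⁻¹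

/-- The Georgii–Nguyen–Zessin identity characterizing `μ ∈ G(z,φ)`. -/
def GNZ {d : ℕ} (z : ℝ) (φ : EucSp d → EReal) (μ : Measure (Config d)) : Prop :=
  ∀ F : Config d → EucSp d → ℝ≥0∞,
    Measurable (Function.uncurry F) →
    ∫⁻ γ, ∑' x : γ.1, F γ x.1 ∂μ
      = ∫⁻ γ, ∫⁻ x, ENNReal.ofReal z * eexp (-(energy φ x γ.1)) * F (γ.ins x) x ∂volume ∂μ


/-- Ordered `n`-tuples of distinct points of `γ`. -/
def injTuples {d : ℕ} (n : ℕ) (γ : Set (EucSp d)) : Set (Fin n → EucSp d) :=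
  {p | Function.Injective p ∧ ∀ i, p i ∈ γ}

/-- `(k_μ^{(n)})` is the family of correlation functions of `μ`: each `k n` is measurable,
nonnegative and symmetric, and for every measurable symmetric `f : (ℝ^d)^n → [0,∞]`,
`∫_Γ ∑_{{x_1,…,x_n} ⊆ γ} f dμ = (1/n!) ∫ f·kₙ dx` (stated equivalently via the sum over
ordered tuples of distinct points, which absorbs the factor `1/n!`). -/
def HasCorrFns {d : ℕ} (μ : Measure (Config d)) (k : ∀ n : ℕ, (Fin n → EucSp d) → ℝ) : Prop :=
  (∀ n : ℕ, Measurable (k n) ∧ (∀ x, 0 ≤ k n x) ∧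
      ∀ (σ : Equiv.Perm (Fin n)) (x : Fin n → EucSp d), k n (x ∘ σ) = k n x) ∧
  ∀ n : ℕ, 0 < n → ∀ f : (Fin n → EucSp d) → ℝ≥0∞, Measurable f →
    (∀ (σ : Equiv.Perm (Fin n)) (x : Fin n → EucSp d), f (x ∘ σ) = f x) →
    ∫⁻ γ, ∑' p : injTuples n γ.1, f p.1 ∂μ
      = ∫⁻ x : Fin n → EucSp d, f x * ENNReal.ofReal (k n x)

/-- The Ruelle bound `k^{(n)} ≤ ξⁿ`. -/
def RuelleBound {d : ℕ} (k : ∀ n : ℕ, (Fin n → EucSp d) → ℝ) (ξ : ℝ) : Prop :=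
  ∀ n : ℕ, 0 < n → ∀ x : Fin n → EucSp d, k n x ≤ ξ ^ n

/-- Translation invariance of a family of functions on tuples. -/
def TransInvFns {d : ℕ} (k : ∀ n : ℕ, (Fin n → EucSp d) → ℝ) : Prop :=
  ∀ (n : ℕ) (a : EucSp d) (x : Fin n → EucSp d), k n (fun i => x i + a) = k n x

/-- `P` is a partition of `{0,…,n-1}` into nonempty pairwise disjoint blocks. -/
def IsPartOfUniv {n : ℕ} (P : Finset (Finset (Fin n))) : Prop :=
  (∀ b ∈ P, b.Nonempty) ∧ (P : Set (Finset (Fin n))).PairwiseDisjoint id ∧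
    P.sup id = Finset.univ

/-- `u` is the family of Ursell functions of `k`:
`k(η) = ∑ u(η_1) ⋯ u(η_j)`, summing over all partitions of `η`. -/
def IsUrsell {d : ℕ} (k u : ∀ n : ℕ, (Fin n → EucSp d) → ℝ) : Prop :=
  ∀ n : ℕ, 0 < n → ∀ x : Fin n → EucSp d,
    k n x = ∑ P : Finset (Finset (Fin n)),
      if IsPartOfUniv P then ∏ b ∈ P, u b.card (fun i => x (b.orderIsoOfFin rfl i).1) else 0

/-- `f ∈ C_0(ℝ^d)`: continuous with compact support. -/
def IsC0 {d : ℕ} (f : EucSp d → ℝ) : Prop := Continuous f ∧ HasCompactSupport f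

/-- Cylinder functions `FC_b(C_0(ℝ^d),Γ)`. -/
def Cyl {d : ℕ} (F : Config d → ℝ) : Prop :=
  ∃ (N : ℕ) (f : Fin N → EucSp d → ℝ) (g : (Fin N → ℝ) → ℝ),
    (∀ i, IsC0 (f i)) ∧ Continuous g ∧ (∃ C, ∀ y, |g y| ≤ C) ∧
    ∀ γ, F γ = g fun i => cpair (f i) γ

/-- `(D_x^- F)(γ) = F(γ∖x) - F(γ)`. -/
def Dminus {d : ℕ} (F : Config d → ℝ) (x : EucSp d) (γ : Config d) : ℝ := F (γ.del x) - F γ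

/-- `(D_x^+ F)(γ) = F(γ∪x) - F(γ)`. -/
def Dplus {d : ℕ} (F : Config d → ℝ) (x : EucSp d) (γ : Config d) : ℝ := F (γ.ins x) - F γ

/-- `(D_{xy}^{-+} F)(γ) = F(γ∖x∪y) - F(γ)`. -/
def Dpm {d : ℕ} (F : Config d → ℝ) (x y : EucSp d) (γ : Config d) : ℝ :=
  F ((γ.del x).ins y) - F γ

/-- The Glauber bilinear form `E_G`. -/
def glauberForm {d : ℕ} (s : ℝ) (φ : EucSp d → EReal) (μ : Measure (Config d))
    (F G : Config d → ℝ) : ℝ :=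
  ∫ γ, (∑' x : γ.1,
      rexp ((s : EReal) * energy φ x.1 (γ.1 \ {x.1})) * Dminus F x.1 γ * Dminus G x.1 γ) ∂μ

/-- The Kawasaki bilinear form `E_K`. -/
def kawasakiForm {d : ℕ} (s : ℝ) (a : EucSp d → ℝ) (φ : EucSp d → EReal)
    (μ : Measure (Config d)) (F G : Config d → ℝ) : ℝ :=
  (1 / 2) * ∫ γ, (∑' x : γ.1, ∫ y : EucSp d,
      a (x.1 - y) *
        rexp ((s : EReal) * energy φ x.1 (γ.1 \ {x.1}) +
          ((s - 1 : ℝ) : EReal) * energy φ y (γ.1 \ {x.1})) *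
        Dpm F x.1 y γ * Dpm G x.1 y γ) ∂μ

/-- The Glauber generator `H_G`. -/
def HG {d : ℕ} (s z : ℝ) (φ : EucSp d → EReal) (F : Config d → ℝ) (γ : Config d) : ℝ :=
  -(∑' x : γ.1, rexp ((s : EReal) * energy φ x.1 (γ.1 \ {x.1})) * Dminus F x.1 γ)
    - ∫ x : EucSp d, z * rexp (((s - 1 : ℝ) : EReal) * energy φ x γ.1) * Dplus F x γ

/-- The Kawasaki generator `H_K`. -/
def HK {d : ℕ} (s : ℝ) (a : EucSp d → ℝ) (φ : EucSp d → EReal) (F : Config d → ℝ)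
    (γ : Config d) : ℝ :=
  -(∑' x : γ.1, ∫ y : EucSp d,
      a (x.1 - y) * rexp ((s : EReal) * energy φ x.1 (γ.1 \ {x.1}) +
        ((s - 1 : ℝ) : EReal) * energy φ y (γ.1 \ {x.1})) * Dpm F x.1 y γ)

/-- The scaled jump kernel `a_ε(x) = ε^d a(ε x)`. -/
def aScaled {d : ℕ} (a : EucSp d → ℝ) (ε : ℝ) (x : EucSp d) : ℝ := ε ^ d * a (ε • x)

/-- `H_ε^-` (death part of the Kawasaki generator with kernel `aa`). -/
def HepsMinus {d : ℕ} (s : ℝ) (aa : EucSp d → ℝ) (φ : EucSp d → EReal)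
    (F : Config d → ℝ) (γ : Config d) : ℝ :=
  -(∑' x : γ.1, Dminus F x.1 γ * ∫ y : EucSp d,
      aa (x.1 - y) * rexp ((s : EReal) * energy φ x.1 (γ.1 \ {x.1}) +
        ((s - 1 : ℝ) : EReal) * energy φ y (γ.1 \ {x.1})))

/-- `H_ε^+` (birth part of the Kawasaki generator with kernel `aa`). -/
def HepsPlus {d : ℕ} (s : ℝ) (aa : EucSp d → ℝ) (φ : EucSp d → EReal)
    (F : Config d → ℝ) (γ : Config d) : ℝ :=
  -(∑' x : γ.1, ∫ y : EucSp d,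
      aa (x.1 - y) * rexp ((s : EReal) * energy φ x.1 (γ.1 \ {x.1}) +
        ((s - 1 : ℝ) : EReal) * energy φ y (γ.1 \ {x.1})) * Dplus F y (γ.del x.1))

/-- `H_0^-` (death part of the Glauber generator). -/
def H0Minus {d : ℕ} (s : ℝ) (φ : EucSp d → EReal) (F : Config d → ℝ) (γ : Config d) : ℝ :=
  -(∑' x : γ.1, rexp ((s : EReal) * energy φ x.1 (γ.1 \ {x.1})) * Dminus F x.1 γ)

/-- `H_0^+` (birth part of the Glauber generator). -/
def H0Plus {d : ℕ} (s z : ℝ) (φ : EucSp d → EReal) (F : Config d → ℝ) (γ : Config d) : ℝ :=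
  -∫ x : EucSp d, z * rexp (((s - 1 : ℝ) : EReal) * energy φ x γ.1) * Dplus F x γ

/-- The standing assumptions of the paper: `s ∈ [0,1/2]`, a stable pair potential in the
low activity–high temperature regime, bounded outside a ball, and `μ` the Gibbs measure
from Ruelle's theorem with its correlation and Ursell functions. -/
structure Setting (d : ℕ) (s z B ξ : ℝ) (φ : EucSp d → EReal) (μ : Measure (Config d))
    (k u : ∀ n : ℕ, (Fin n → EucSp d) → ℝ) : Prop where
  hd : 0 < d
  hs0 : 0 ≤ s
  hs1 : s ≤ 1 / 2
  pp : IsPairPotential φ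
  hB : 0 ≤ B
  stable : Stable φ B
  hz : 0 < z
  laht : LAHT φ z B
  bddOutside : ∃ R C : ℝ, ∀ x : EucSp d, R ≤ ‖x‖ → ∃ r : ℝ, φ x = (r : EReal) ∧ |r| ≤ C
  prob : IsProbabilityMeasure μ
  gnz : GNZ z φ μ
  corr : HasCorrFns μ k
  ti : TransInvFns k
  hξ : 0 < ξ
  ruelle : RuelleBound k ξ
  ursell : IsUrsell k u
  ursellInt : ∀ m : ℕ,
    Integrable (fun y : Fin (m + 1) → EucSp d => u (m + 2) (Fin.cons 0 y)) volume

/-- The jump kernel `a`: bounded, nonnegative, even, integrable. -/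
structure GoodA {d : ℕ} (a : EucSp d → ℝ) : Prop where
  meas : Measurable a
  nonneg : ∀ x, 0 ≤ a x
  bdd : ∃ C, ∀ x, a x ≤ C
  even : ∀ x, a (-x) = a x
  int : Integrable a volume

/-- `φ(x) → 0` as `|x| → ∞`. -/
def PhiVanishes {d : ℕ} (φ : EucSp d → EReal) : Prop :=
  Tendsto φ (cocompact (EucSp d)) (nhds (0 : EReal))

/-- The normalization `∫ a dx = (∫_Γ exp[(s-1) ∑_{u∈γ} φ(u)] dμ(γ))⁻¹`. -/
def NormalizedA {d : ℕ} (s : ℝ) (a : EucSp d → ℝ) (φ : EucSp d → EReal)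
    (μ : Measure (Config d)) : Prop :=
  (∫ x : EucSp d, a x) = (∫ γ, rexp (((s - 1 : ℝ) : EReal) * totPhi φ γ.1) ∂μ)⁻¹


open ProbabilityTheory

/-- The counting measure carried by a configuration. -/
def pointMeasure {d : ℕ} (γ : Config d) : Measure (EucSp d) :=
  Measure.sum fun x : γ.1 => Measure.dirac x.1

lemma lintegral_pointMeasure {d : ℕ} (γ : Config d) (h : EucSp d → ℝ≥0∞) :
    ∫⁻ x, h x ∂(pointMeasure γ) = ∑' x : γ.1, h x.1 := by
  simp [pointMeasure, lintegral_sum_measure]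

lemma pointMeasure_apply {d : ℕ} (γ : Config d) {A : Set (EucSp d)} (hA : MeasurableSet A) :
    pointMeasure γ A = ((γ.1 ∩ A).encard : ℝ≥0∞) := by
  rw [← lintegral_indicator_one hA, lintegral_pointMeasure, ← ENNReal.tsum_set_one,
    tsum_subtype γ.1 (A.indicator (1 : EucSp d → ℝ≥0∞)),
    tsum_subtype (γ.1 ∩ A) (fun _ => (1 : ℝ≥0∞)), indicator_indicator]
  rfl

lemma measurable_encard_inter {d : ℕ} {A : Set (EucSp d)} (hA : MeasurableSet A) :
    Measurable[Config.instMS d, ⊤] fun γ : Config d => (γ.1 ∩ A).encard :=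
  (comap_measurable _).mono (le_iSup₂_of_le A hA le_rfl) le_rfl

/-- The kernel sending a configuration to its counting measure. -/
def pointKernel (d : ℕ) : Kernel (Config d) (EucSp d) where
  toFun := pointMeasure
  measurable' := by
    refine Measure.measurable_of_measurable_coe _ fun A hA => ?_
    simp_rw [pointMeasure_apply _ hA]
    exact (measurable_from_top (f := fun n : ℕ∞ => (n : ℝ≥0∞))).comp
      (measurable_encard_inter hA)

lemma pointKernel_apply {d : ℕ} (γ : Config d) : pointKernel d γ = pointMeasure γ := rfl

lemma Kernel.isSFiniteKernel_of_isFiniteMeasure {α β : Type*} [MeasurableSpace α]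
    [MeasurableSpace β] (κ : Kernel α β) (h : ∀ a, κ a univ < ∞) : IsSFiniteKernel κ := by
  have hm : ∀ n : ℕ, MeasurableSet {a | ⌊(κ a univ).toReal⌋₊ = n} := fun n =>
    (Nat.measurable_floor.comp (κ.measurable_coe MeasurableSet.univ).ennreal_toReal)
      (measurableSet_singleton n)
  have hfin : ∀ n : ℕ, IsFiniteKernel (Kernel.piecewise (hm n) κ 0) := fun n => by
    refine ⟨⟨ENNReal.ofReal (n + 1), ENNReal.ofReal_lt_top, fun a => ?_⟩⟩
    rw [Kernel.piecewise_apply]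
    split_ifs with ha
    · rw [ENNReal.le_ofReal_iff_toReal_le (h a).ne (by positivity)]
      have := Nat.lt_floor_add_one (κ a univ).toReal
      rw [show ⌊(κ a univ).toReal⌋₊ = n from ha] at this
      exact this.le
    · simp
  have : κ = Kernel.sum fun n : ℕ => Kernel.piecewise (hm n) κ 0 := by
    ext a s hs
    rw [Kernel.sum_apply' _ _ hs, tsum_eq_single ⌊(κ a univ).toReal⌋₊]
    · rw [Kernel.piecewise_apply, if_pos (by rfl)]
    · intro n hn
      rw [Kernel.piecewise_apply, if_neg (by exact fun e => hn e.symm)]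
      simp
  rw [this]
  exact Kernel.isSFiniteKernel_sum

instance pointKernel.instIsSFiniteKernel (d : ℕ) : IsSFiniteKernel (pointKernel d) := by
  set A : ℕ → Set (EucSp d) := disjointed fun n : ℕ => Metric.closedBall 0 n with hA
  have hAm : ∀ n, MeasurableSet (A n) := fun n =>
    MeasurableSet.disjointed (fun _ => Metric.isClosed_closedBall.measurableSet) n
  have hfin : ∀ n, IsSFiniteKernel ((pointKernel d).restrict (hAm n)) := fun n => by
    refine Kernel.isSFiniteKernel_of_isFiniteMeasure _ fun γ => ?_
    rw [Kernel.restrict_apply' _ _ _ MeasurableSet.univ, univ_inter]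
    refine (measure_mono (disjointed_subset _ n)).trans_lt ?_
    rw [pointKernel_apply, pointMeasure_apply _ Metric.isClosed_closedBall.measurableSet]
    have := γ.2 (Metric.closedBall 0 n) (isCompact_closedBall 0 _)
    rw [← this.cast_ncard_eq]
    exact ENNReal.natCast_lt_top _
  have : pointKernel d = Kernel.sum fun n => (pointKernel d).restrict (hAm n) := by
    ext γ s hs
    rw [Kernel.sum_apply' _ _ hs]
    simp_rw [Kernel.restrict_apply' _ _ _ hs]
    rw [← measure_iUnion (fun i j hij => (disjoint_disjointed _ hij).mono
      inter_subset_right inter_subset_right) fun n => hs.inter (hAm n), ← inter_iUnion,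
      iUnion_disjointed]
    congr
    symm
    rw [inter_eq_left]
    intro x _
    obtain ⟨n, hn⟩ := exists_nat_ge ‖x‖
    exact mem_iUnion.2 ⟨n, by simpa using hn⟩
  rw [this]
  exact Kernel.isSFiniteKernel_sum

instance pointMeasure.instSFinite {d : ℕ} (γ : Config d) : SFinite (pointMeasure γ) :=
  inferInstanceAs (SFinite (pointKernel d γ))

section Measurability

variable {d : ℕ} {X : Type*} [MeasurableSpace X]

lemma measurable_tsum_config {c : X → Config d} (hc : Measurable c) {g : X → EucSp d → ℝ≥0∞}
    (hg : Measurable (Function.uncurry g)) : Measurable fun x => ∑' y : (c x).1, g x y.1 := by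
  have := Measurable.lintegral_kernel_prod_right' (κ := (pointKernel d).comap c hc) hg
  simpa only [Kernel.comap_apply, pointKernel_apply, lintegral_pointMeasure,
    Function.uncurry_apply_pair] using this

lemma measurable_config_of_tsum {c : X → Config d}
    (h : ∀ A : Set (EucSp d), MeasurableSet A →
      Measurable fun x => ∑' y : (c x).1, A.indicator (1 : EucSp d → ℝ≥0∞) y.1) :
    Measurable c := by
  rw [measurable_iff_comap_le, Config.instMS, MeasurableSpace.comap_iSup]
  refine iSup_le fun A => ?_
  rw [MeasurableSpace.comap_iSup]
  refine iSup_le fun hA => ?_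
  rw [MeasurableSpace.comap_comp, ← measurable_iff_comap_le]
  refine @measurable_to_countable' _ _ ⊤ _ _ _ fun n => ?_
  have := h A hA
  simp_rw [← lintegral_pointMeasure, lintegral_indicator_one hA, pointMeasure_apply _ hA] at this
  convert this (measurableSet_singleton (n : ℝ≥0∞)) using 1
  ext x
  simp

lemma tsum_config_eq {γ : Config d} (g : EucSp d → ℝ≥0∞) :
    ∑' y : γ.1, g y.1 = ∑' y, γ.1.indicator g y := tsum_subtype γ.1 g

lemma tsum_del (γ : Config d) (x : EucSp d) (g : EucSp d → ℝ≥0∞) :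
    ∑' y : (γ.del x).1, g y.1 = ∑' y : γ.1, if y.1 = x then 0 else g y.1 := by
  rw [tsum_config_eq, tsum_config_eq fun y => if y = x then 0 else g y]
  congr with y
  by_cases h : y = x <;> by_cases h' : y ∈ γ.1 <;> simp [Config.del, indicator, h, h']

lemma tsum_ins (γ : Config d) (x : EucSp d) (g : EucSp d → ℝ≥0∞) :
    ∑' y : (γ.ins x).1, g y.1 = g x + ∑' y : (γ.del x).1, g y.1 := by
  rw [tsum_config_eq, tsum_config_eq, ENNReal.tsum_eq_add_tsum_ite x]
  congr 1
  · simp [Config.ins]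
  · congr with y
    by_cases h : y = x <;> simp [Config.del, Config.ins, indicator, h]

lemma measurable_del {c : X → Config d} (hc : Measurable c) {x : X → EucSp d}
    (hx : Measurable x) : Measurable fun p => (c p).del (x p) := by
  refine measurable_config_of_tsum fun A hA => ?_
  simp_rw [tsum_del]
  refine measurable_tsum_config
    (g := fun p y => if y = x p then 0 else A.indicator (1 : EucSp d → ℝ≥0∞) y) hc ?_
  exact Measurable.ite (measurableSet_eq_fun measurable_snd (hx.comp measurable_fst))
    measurable_const ((measurable_one.indicator hA).comp measurable_snd)

lemma measurable_ins {c : X → Config d} (hc : Measurable c) {x : X → EucSp d}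
    (hx : Measurable x) : Measurable fun p => (c p).ins (x p) := by
  refine measurable_config_of_tsum fun A hA => ?_
  simp_rw [tsum_ins]
  refine ((measurable_one.indicator hA).comp hx).add ?_
  exact measurable_tsum_config (g := fun _ => A.indicator (1 : EucSp d → ℝ≥0∞))
    (measurable_del hc hx) ((measurable_one.indicator hA).comp measurable_snd)

lemma tsum_enorm_ne_top_iff {ι : Type*} {g : ι → ℝ} :
    ∑' i, ‖g i‖ₑ ≠ ∞ ↔ Summable g := by
  rw [← summable_norm_iff]
  exact ENNReal.tsum_coe_ne_top_iff_summable.trans NNReal.summable_coe.symm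

lemma tsum_eq_toReal_sub_toReal {ι : Type*} {g : ι → ℝ} (hg : Summable g) :
    ∑' i, g i = (∑' i, ENNReal.ofReal (g i)).toReal - (∑' i, ENNReal.ofReal (-g i)).toReal := by
  rw [ENNReal.tsum_toReal_eq (by simp), ENNReal.tsum_toReal_eq (by simp)]
  simp_rw [ENNReal.toReal_ofReal']
  rw [← Summable.tsum_sub]
  · congr with i
    exact (max_zero_sub_eq_self (g i)).symm
  · exact Summable.of_nonneg_of_le (fun i => le_max_right _ _)
      (fun i => max_le (le_abs_self _) (abs_nonneg _)) hg.abs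
  · exact Summable.of_nonneg_of_le (fun i => le_max_right _ _)
      (fun i => max_le (neg_le_abs _) (abs_nonneg _)) hg.abs

lemma measurableSet_summable_config {c : X → Config d} (hc : Measurable c)
    {g : X → EucSp d → ℝ} (hg : Measurable (Function.uncurry g)) :
    MeasurableSet {x | Summable fun y : (c x).1 => g x y.1} := by
  simp_rw [← tsum_enorm_ne_top_iff]
  exact (measurable_tsum_config (g := fun x y => ‖g x y‖ₑ) hc hg.enorm
    (measurableSet_singleton ∞)).compl

lemma measurable_real_tsum_config {c : X → Config d} (hc : Measurable c)
    {g : X → EucSp d → ℝ} (hg : Measurable (Function.uncurry g)) :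
    Measurable fun x => ∑' y : (c x).1, g x y.1 := by
  have : (fun x => ∑' y : (c x).1, g x y.1) = fun x =>
      if Summable (fun y : (c x).1 => g x y.1) then
        (∑' y : (c x).1, ENNReal.ofReal (g x y.1)).toReal
          - (∑' y : (c x).1, ENNReal.ofReal (-g x y.1)).toReal else 0 := by
    ext x
    split_ifs with h
    · exact tsum_eq_toReal_sub_toReal h
    · exact tsum_eq_zero_of_not_summable h
  rw [this]
  refine Measurable.ite (measurableSet_summable_config hc hg) (.sub ?_ ?_) measurable_const
  · exact (measurable_tsum_config (g := fun x y => ENNReal.ofReal (g x y)) hc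
      hg.ennreal_ofReal).ennreal_toReal
  · exact (measurable_tsum_config (g := fun x y => ENNReal.ofReal (-g x y)) hc
      hg.neg.ennreal_ofReal).ennreal_toReal

lemma measurable_cpair {c : X → Config d} (hc : Measurable c) {f : EucSp d → ℝ}
    (hf : Measurable f) : Measurable fun x => cpair f (c x) :=
  measurable_real_tsum_config (g := fun _ => f) hc (hf.comp measurable_snd)

lemma measurable_energy {φ : EucSp d → EReal} (hφ : Measurable φ) {c : X → Config d}
    (hc : Measurable c) {x : X → EucSp d} (hx : Measurable x) :
    Measurable fun p => energy φ (x p) (c p).1 := by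
  have hsub : Measurable fun q : X × EucSp d => φ (x q.1 - q.2) :=
    hφ.comp ((hx.comp measurable_fst).sub measurable_snd)
  refine Measurable.ite (.inter ?_ ?_) ?_ measurable_const
  · have hm : Measurable fun p => ∑' y : (c p).1, if φ (x p - y.1) = ⊤ then (1 : ℝ≥0∞) else 0 :=
      measurable_tsum_config (g := fun p y => if φ (x p - y) = ⊤ then (1 : ℝ≥0∞) else 0) hc
        (Measurable.ite (hsub (measurableSet_singleton ⊤)) measurable_const measurable_const)
    have hs : MeasurableSet {p | ∀ y ∈ (c p).1, φ (x p - y) ≠ ⊤} := by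
      convert hm (measurableSet_singleton 0) using 1
      ext p
      simp
    exact hs
  · exact measurableSet_summable_config (g := fun p y => (φ (x p - y)).toReal) hc hsub.ereal_toReal
  · exact (measurable_real_tsum_config (g := fun p y => (φ (x p - y)).toReal) hc
      hsub.ereal_toReal).coe_real_ereal

end Measurability

lemma measurable_eexp : Measurable eexp :=
  Measurable.ite (measurableSet_singleton _) measurable_const <|
    Measurable.ite (measurableSet_singleton _) measurable_const
      (Real.measurable_exp.comp measurable_ereal_toReal).ennreal_ofReal

lemma measurable_rexp : Measurable rexp := measurable_eexp.ennreal_toReal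

section Correlation

variable {d : ℕ}

lemma cons_mem_injTuples_iff {γ : Config d} {n : ℕ} {x : EucSp d} {p : Fin n → EucSp d} :
    (Fin.cons x p : Fin (n + 1) → EucSp d) ∈ injTuples (n + 1) γ.1 ↔
      x ∈ γ.1 ∧ p ∈ injTuples n (γ.del x).1 := by
  simp only [injTuples, mem_ofPred_eq, Fin.cons_injective_iff, Fin.forall_fin_succ, Fin.cons_zero,
    Fin.cons_succ, Config.del, Set.mem_sdiff, mem_singleton_iff, mem_range, not_exists]
  constructor
  · rintro ⟨⟨h1, h2⟩, h3, h4⟩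
    exact ⟨h3, h2, fun i => ⟨h4 i, h1 i⟩⟩
  · rintro ⟨h3, h2, h4⟩
    exact ⟨⟨fun i => (h4 i).2, h2⟩, h3, fun i => (h4 i).1⟩

/-- Splitting off the first entry of a tuple of distinct points. -/
def injTuplesSuccEquiv (γ : Config d) (n : ℕ) :
    (Σ x : γ.1, injTuples n (γ.del x.1).1) ≃ injTuples (n + 1) γ.1 where
  toFun q := ⟨Fin.cons q.1.1 q.2.1, cons_mem_injTuples_iff.2 ⟨q.1.2, q.2.2⟩⟩
  invFun p :=
    have h := cons_mem_injTuples_iff.1 ((Fin.cons_self_tail p.1).symm ▸ p.2)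
    ⟨⟨p.1 0, h.1⟩, ⟨Fin.tail p.1, h.2⟩⟩
  left_inv q := by
    rcases q with ⟨⟨x, hx⟩, ⟨p, hp⟩⟩
    rfl
  right_inv p := Subtype.ext (Fin.cons_self_tail p.1)

lemma tsum_injTuples_succ (γ : Config d) (n : ℕ) (g : (Fin (n + 1) → EucSp d) → ℝ≥0∞) :
    ∑' p : injTuples (n + 1) γ.1, g p.1
      = ∑' x : γ.1, ∑' p : injTuples n (γ.del x.1).1, g (Fin.cons x.1 p.1) := by
  rw [← (injTuplesSuccEquiv γ n).tsum_eq, ENNReal.tsum_sigma']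
  rfl

/-- The sum of `∏ g(xᵢ)` over the ordered `n`-tuples of distinct points of `γ`. -/
def tupleSum (g : EucSp d → ℝ≥0∞) (n : ℕ) (γ : Config d) : ℝ≥0∞ :=
  ∑' p : injTuples n γ.1, ∏ i, g (p.1 i)

lemma tupleSum_succ (g : EucSp d → ℝ≥0∞) (n : ℕ) (γ : Config d) :
    tupleSum g (n + 1) γ = ∑' x : γ.1, g x.1 * tupleSum g n (γ.del x.1) := by
  rw [tupleSum, tsum_injTuples_succ γ n fun p => ∏ i, g (p i)]
  simp_rw [Fin.prod_univ_succ, Fin.cons_zero, Fin.cons_succ, ENNReal.tsum_mul_left]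
  rfl

lemma tupleSum_zero (g : EucSp d → ℝ≥0∞) (γ : Config d) : tupleSum g 0 γ = 1 := by
  have : injTuples 0 γ.1 = {Fin.elim0} := by
    ext p
    simp [injTuples, Function.injective_of_subsingleton, eq_iff_true_of_subsingleton]
  rw [tupleSum, this]
  simp

lemma measurable_tupleSum {g : EucSp d → ℝ≥0∞} (hg : Measurable g) (n : ℕ) :
    Measurable (tupleSum g n) := by
  induction n with
  | zero =>
    rw [show tupleSum g 0 = fun _ => 1 from funext (tupleSum_zero g)]
    exact measurable_const
  | succ n ih =>
    rw [show tupleSum g (n + 1) = _ from funext (tupleSum_succ g n)]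
    exact measurable_tsum_config (g := fun γ x => g x * tupleSum g n (γ.del x)) measurable_id
      ((hg.comp measurable_snd).mul (ih.comp (measurable_del measurable_fst measurable_snd)))

lemma factorial_mul_sum_powersetCard_le (g : EucSp d → ℝ≥0∞) (n : ℕ) (γ : Config d)
    (S : Finset γ.1) :
    (n.factorial : ℝ≥0∞) * ∑ T ∈ S.powersetCard n, ∏ y ∈ T, g y.1 ≤ tupleSum g n γ := by
  let F : (Σ T : S.powersetCard n, (Fin n ≃ T.1)) → injTuples n γ.1 := fun q =>
    ⟨fun i => (q.2 i).1.1, fun i j h => q.2.injective (Subtype.ext (Subtype.ext h)),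
      fun i => (q.2 i).1.2⟩
  have hF : Function.Injective F := by
    rintro ⟨T, e⟩ ⟨T', e'⟩ h
    have h1 : ∀ i, (e i).1 = (e' i).1 := fun i =>
      Subtype.ext (congrFun (congrArg Subtype.val h) i)
    have hsub : T = T' := by
      refine Subtype.ext (Finset.ext fun y => ⟨fun hy => ?_, fun hy => ?_⟩)
      · have := h1 (e.symm ⟨y, hy⟩)
        rw [e.apply_symm_apply] at this
        exact (show y = _ from this) ▸ (e' _).2
      · have := h1 (e'.symm ⟨y, hy⟩)
        rw [e'.apply_symm_apply] at this
        exact (show _ = y from this) ▸ (e _).2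
    subst hsub
    congr 1
    exact Equiv.ext fun i => Subtype.ext (h1 i)
  refine le_trans (le_of_eq ?_) (ENNReal.tsum_comp_le_tsum_of_injective hF _)
  rw [ENNReal.tsum_sigma', tsum_fintype, Finset.mul_sum, ← Finset.sum_coe_sort]
  refine Finset.sum_congr rfl fun T _ => ?_
  have hT : T.1.card = n := (Finset.mem_powersetCard.1 T.2).2
  have hprod : ∀ e : Fin n ≃ T.1, ∏ i, g ((F ⟨T, e⟩).1 i) = ∏ y ∈ T.1, g y.1 := fun e => by
    rw [← Finset.prod_coe_sort T.1]
    exact Fintype.prod_equiv e _ _ fun i => rfl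
  simp_rw [hprod]
  rw [tsum_fintype, Finset.sum_const, Finset.card_univ,
    Fintype.card_equiv ((Fin.castOrderIso hT.symm).toEquiv.trans T.1.equivFin.symm), Fintype.card_fin,
    nsmul_eq_mul]

lemma prod_one_add_le_tsum_tupleSum (g : EucSp d → ℝ≥0∞) (γ : Config d) (S : Finset γ.1) :
    ∏ y ∈ S, (1 + g y.1) ≤ ∑' n : ℕ, (n.factorial : ℝ≥0∞)⁻¹ * tupleSum g n γ := by
  rw [Finset.prod_one_add, Finset.sum_powerset]
  refine le_trans (Finset.sum_le_sum fun n _ => ?_) (ENNReal.sum_le_tsum (Finset.range (S.card + 1)))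
  have h0 : (n.factorial : ℝ≥0∞) ≠ 0 := by exact_mod_cast n.factorial_ne_zero
  calc _ = (n.factorial : ℝ≥0∞)⁻¹ * (n.factorial * ∑ T ∈ S.powersetCard n, ∏ y ∈ T, g y.1) := by
        rw [← mul_assoc, ENNReal.inv_mul_cancel h0 (ENNReal.natCast_ne_top _), one_mul]
    _ ≤ _ := by gcongr; exact factorial_mul_sum_powersetCard_le g n γ S

lemma exp_tsum_le_tsum_tupleSum {ψ : EucSp d → ℝ} (hψ : ∀ y, 0 ≤ ψ y) (γ : Config d) :
    ENNReal.ofReal (Real.exp (∑' y : γ.1, ψ y.1)) ≤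
      ∑' n : ℕ, (n.factorial : ℝ≥0∞)⁻¹ *
        tupleSum (fun y => ENNReal.ofReal (Real.exp (ψ y) - 1)) n γ := by
  have hle : ∀ S : Finset γ.1, ENNReal.ofReal (Real.exp (∑ y ∈ S, ψ y.1)) ≤ _ := fun S =>
    le_trans (le_of_eq ?_)
      (prod_one_add_le_tsum_tupleSum (fun y => ENNReal.ofReal (Real.exp (ψ y) - 1)) γ S)
  · by_cases hs : Summable fun y : γ.1 => ψ y.1
    · refine le_of_tendsto' ((ENNReal.continuous_ofReal.comp Real.continuous_exp).tendsto _ |>.comp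
        hs.hasSum) hle
    · rw [tsum_eq_zero_of_not_summable hs]
      simpa using hle ∅
  · rw [Real.exp_sum, ENNReal.ofReal_prod_of_nonneg fun _ _ => (Real.exp_pos _).le]
    refine Finset.prod_congr rfl fun y _ => ?_
    rw [← ENNReal.ofReal_one, ← ENNReal.ofReal_add zero_le_one
      (sub_nonneg.2 (Real.one_le_exp (hψ _)))]
    simp

lemma lintegral_tupleSum_le {μ : Measure (Config d)} [IsProbabilityMeasure μ]
    {k : ∀ n : ℕ, (Fin n → EucSp d) → ℝ} {ξ : ℝ} (hk : HasCorrFns μ k)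
    (hR : RuelleBound k ξ) {g : EucSp d → ℝ} (hg0 : ∀ y, 0 ≤ g y) (hgm : Measurable g)
    (hg : Integrable g) (n : ℕ) :
    ∫⁻ γ, tupleSum (fun y => ENNReal.ofReal (g y)) n γ ∂μ
      ≤ ENNReal.ofReal ((ξ * ∫ y, g y) ^ n) := by
  rcases Nat.eq_zero_or_pos n with rfl | hn
  · simp [tupleSum_zero]
  · simp_rw [tupleSum, ← ENNReal.ofReal_prod_of_nonneg fun i _ => hg0 _]
    rw [hk.2 n hn (fun p => ENNReal.ofReal (∏ i, g (p i)))
      (Finset.measurable_prod _ fun i _ => hgm.comp (measurable_pi_apply i)).ennreal_ofReal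
      fun σ x => by simp only [Function.comp]; rw [Equiv.prod_comp σ fun i => g (x i)]]
    calc _ ≤ ∫⁻ x : Fin n → EucSp d, ENNReal.ofReal (∏ i, g (x i)) * ENNReal.ofReal (ξ ^ n) := by
          gcongr with x
          exact hR n hn x
      _ = _ := by
          rw [lintegral_mul_const' _ _ ENNReal.ofReal_ne_top, volume_pi,
            ← ofReal_integral_eq_lintegral_ofReal (Integrable.fintype_prod fun _ => hg)
              (ae_of_all _ fun x => Finset.prod_nonneg fun i _ => hg0 _),
            integral_fintype_prod_eq_prod, ← ENNReal.ofReal_mul (Finset.prod_nonneg fun i _ =>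
              integral_nonneg hg0)]
          simp [mul_pow, mul_comm]

lemma lintegral_exp_tsum_le {μ : Measure (Config d)} [IsProbabilityMeasure μ]
    {k : ∀ n : ℕ, (Fin n → EucSp d) → ℝ} {ξ : ℝ} (hξ : 0 < ξ) (hk : HasCorrFns μ k)
    (hR : RuelleBound k ξ) {ψ : EucSp d → ℝ} (hψ : ∀ y, 0 ≤ ψ y) (hψm : Measurable ψ)
    (hi : Integrable fun y => Real.exp (ψ y) - 1) :
    ∫⁻ γ, ENNReal.ofReal (Real.exp (∑' y : γ.1, ψ y.1)) ∂μ
      ≤ ENNReal.ofReal (Real.exp (ξ * ∫ y, (Real.exp (ψ y) - 1))) := by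
  have hm : Measurable fun y => Real.exp (ψ y) - 1 := (Real.measurable_exp.comp hψm).sub_const _
  have h0 : ∀ y, 0 ≤ Real.exp (ψ y) - 1 := fun y => sub_nonneg.2 (Real.one_le_exp (hψ y))
  have hpos : 0 ≤ ξ * ∫ y, (Real.exp (ψ y) - 1) := mul_nonneg hξ.le (integral_nonneg h0)
  have hexp : ∀ t : ℝ, Real.exp t = ∑' n : ℕ, t ^ n / n.factorial := fun t => by
    rw [Real.exp_eq_exp_ℝ, NormedSpace.exp_eq_tsum_div]
  refine (lintegral_mono fun γ => exp_tsum_le_tsum_tupleSum hψ γ).trans ?_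
  rw [lintegral_tsum fun n => ((measurable_tupleSum hm.ennreal_ofReal n).const_mul _).aemeasurable,
    hexp (ξ * _), ENNReal.ofReal_tsum_of_nonneg (fun n => div_nonneg (pow_nonneg hpos n) (by positivity))
      (Real.summable_pow_div_factorial _)]
  refine ENNReal.tsum_le_tsum fun n => ?_
  rw [lintegral_const_mul _ (measurable_tupleSum hm.ennreal_ofReal n),
    ENNReal.ofReal_div_of_pos (by positivity), ENNReal.ofReal_natCast, div_eq_mul_inv, mul_comm]
  gcongr
  exact lintegral_tupleSum_le hk hR h0 hm hi n

lemma lintegral_tsum_le {μ : Measure (Config d)}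
    {k : ∀ n : ℕ, (Fin n → EucSp d) → ℝ} {ξ : ℝ} (hk : HasCorrFns μ k)
    (hR : RuelleBound k ξ) {h : EucSp d → ℝ≥0∞} (hh : Measurable h) :
    ∫⁻ γ, ∑' y : γ.1, h y.1 ∂μ ≤ ENNReal.ofReal ξ * ∫⁻ y, h y := by
  have h1 : ∀ γ : Config d, ∑' y : γ.1, h y.1 = ∑' p : injTuples 1 γ.1, h (p.1 0) := fun γ => by
    have := tupleSum_succ h 0 γ
    simp only [tupleSum_zero, mul_one] at this
    rw [← this, tupleSum]
    simp
  simp_rw [h1]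
  rw [hk.2 1 one_pos (fun p => h (p 0)) (hh.comp (measurable_pi_apply 0))
    fun σ x => by rw [Subsingleton.elim σ 1]; rfl]
  calc _ ≤ ∫⁻ x : Fin 1 → EucSp d, h (x 0) * ENNReal.ofReal ξ := by
        gcongr with x
        simpa using hR 1 one_pos x
    _ = _ := by
        rw [lintegral_mul_const' _ _ ENNReal.ofReal_ne_top, mul_comm]
        congr 1
        exact (volume_preserving_funUnique (Fin 1) (EucSp d)).lintegral_comp hh

end Correlation

section Energy

variable {d : ℕ}

lemma rexp_coe (r : ℝ) : rexp (r : EReal) = Real.exp r := by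
  simp [rexp, eexp, (Real.exp_pos r).le]

lemma rexp_nonneg (r : EReal) : 0 ≤ rexp r := ENNReal.toReal_nonneg

lemma eexp_neg_lt_top {r : EReal} (h : r ≠ ⊥) : eexp (-r) < ∞ := by
  unfold eexp
  rw [if_neg (by simpa [EReal.neg_eq_top_iff] using h)]
  split_ifs
  · simp
  · exact ENNReal.ofReal_lt_top

lemma energy_ne_bot (φ : EucSp d → EReal) (x : EucSp d) (γ : Set (EucSp d)) :
    energy φ x γ ≠ ⊥ := by
  unfold energy
  split_ifs
  · exact EReal.coe_ne_bot _
  · exact top_ne_bot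

lemma energy_ne_top_iff {φ : EucSp d → EReal} {x : EucSp d} {γ : Set (EucSp d)} :
    energy φ x γ ≠ ⊤ ↔
      (∀ y ∈ γ, φ (x - y) ≠ ⊤) ∧ Summable fun y : γ => (φ (x - y.1)).toReal := by
  unfold energy
  split_ifs with h
  · simpa using h
  · simpa using h

lemma energy_eq_coe_tsum {φ : EucSp d → EReal} {x : EucSp d} {γ : Set (EucSp d)}
    (h : energy φ x γ ≠ ⊤) : energy φ x γ = ((∑' y : γ, (φ (x - y.1)).toReal : ℝ) : EReal) :=
  if_pos (energy_ne_top_iff.1 h)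

lemma energy_eq_coe_toReal {φ : EucSp d → EReal} {x : EucSp d} {γ : Set (EucSp d)}
    (h : energy φ x γ ≠ ⊤) : energy φ x γ = ((energy φ x γ).toReal : EReal) :=
  (EReal.coe_toReal h (energy_ne_bot φ x γ)).symm

/-- The negative part of the pair potential. -/
def negPhi (φ : EucSp d → EReal) (u : EucSp d) : ℝ := max (-(φ u).toReal) 0

lemma negPhi_nonneg (φ : EucSp d → EReal) (u : EucSp d) : 0 ≤ negPhi φ u := le_max_right _ _

lemma measurable_negPhi {φ : EucSp d → EReal} (hφ : Measurable φ) : Measurable (negPhi φ) :=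
  hφ.ereal_toReal.neg.max measurable_const

lemma Stable.neg_le_toReal {φ : EucSp d → EReal} {B : ℝ} (hs : Stable φ B)
    (hφ : IsPairPotential φ) {x : EucSp d} (hx : x ≠ 0) : -(2 * B) ≤ (φ x).toReal := by
  have h := hs {x, 0}
  have ho : ({x, 0} : Finset (EucSp d)).offDiag = {(x, 0), (0, x)} := by
    ext ⟨a, b⟩
    simp only [Finset.mem_offDiag, Finset.mem_insert, Finset.mem_singleton, Prod.mk.injEq]
    constructor
    · rintro ⟨rfl | rfl, rfl | rfl, h⟩ <;> simp_all
    · rintro (⟨rfl, rfl⟩ | ⟨rfl, rfl⟩) <;> simp [hx, Ne.symm hx]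
  rw [ho, Finset.card_pair hx, Finset.sum_pair (by simp [hx]), sub_zero,
    zero_sub, hφ.even x hx, ← EReal.coe_toReal (hφ.finite_off x hx) (hφ.ne_bot x),
    ← EReal.coe_add, EReal.coe_le_coe_iff] at h
  push_cast at h
  linarith

lemma exists_negPhi_le {φ : EucSp d → EReal} {B : ℝ} (hs : Stable φ B)
    (hφ : IsPairPotential φ) : ∃ M : ℝ, 0 ≤ M ∧ ∀ u, negPhi φ u ≤ M := by
  refine ⟨max (2 * B) (negPhi φ 0), le_max_of_le_right (negPhi_nonneg _ _), fun u => ?_⟩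
  by_cases hu : u = 0
  · exact hu ▸ le_max_right _ _
  · have := hs.neg_le_toReal hφ hu
    have h0 := negPhi_nonneg φ 0
    rw [negPhi]
    refine max_le (le_max_of_le_left (by linarith)) (le_max_of_le_right h0)

lemma rexp_neg_of_ne_top {r : EReal} (h : r ≠ ⊤) (h' : r ≠ ⊥) :
    rexp (-r) = Real.exp (-r.toReal) := by
  lift r to ℝ using ⟨h, h'⟩
  rw [← EReal.coe_neg, rexp_coe, EReal.toReal_coe]

lemma LAHT.integrable {φ : EucSp d → EReal} {z B : ℝ} (h : LAHT φ z B) (hz : 0 < z)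
    (hφ : Measurable φ) : Integrable fun x => |rexp (-(φ x)) - 1| := by
  have hm : Measurable fun x => |rexp (-(φ x)) - 1| :=
    ((measurable_rexp.comp hφ.neg).sub_const 1).abs
  have hi : Integrable fun x => |rexp (-(φ x)) - 1| * z := by
    refine ⟨(hm.mul_const z).aestronglyMeasurable, ?_⟩
    rw [hasFiniteIntegral_iff_ofReal (ae_of_all _ fun x => by positivity)]
    exact h.trans ENNReal.ofReal_lt_top
  simpa [mul_assoc, hz.ne'] using hi.mul_const z⁻¹

lemma neg_max_le_abs_exp (t : ℝ) : max (-t) 0 ≤ |Real.exp (-t) - 1| :=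
  max_le (by have := Real.add_one_le_exp (-t); exact le_abs.2 (.inl (by linarith))) (abs_nonneg _)

lemma abs_le_exp_mul_abs_exp {t C : ℝ} (h : |t| ≤ C) :
    |t| ≤ Real.exp C * |Real.exp (-t) - 1| := by
  have hC : 1 ≤ Real.exp C := Real.one_le_exp ((abs_nonneg t).trans h)
  rcases le_total t 0 with ht | ht
  · rw [abs_of_nonpos ht]
    have := neg_max_le_abs_exp t
    have h2 := (le_max_left (-t) 0).trans this
    nlinarith [abs_nonneg (Real.exp (-t) - 1)]
  · rw [abs_of_nonneg ht] at h ⊢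
    have h1 : t + 1 ≤ Real.exp t := Real.add_one_le_exp t
    have h2 : Real.exp t * Real.exp (-t) = 1 := by rw [← Real.exp_add]; simp
    have h3 : Real.exp t ≤ Real.exp C := Real.exp_le_exp.2 h
    have h4 : 1 - Real.exp (-t) ≤ |Real.exp (-t) - 1| := by rw [abs_sub_comm]; exact le_abs_self _
    have h5 : 0 ≤ 1 - Real.exp (-t) := by
      have : Real.exp (-t) ≤ 1 := Real.exp_le_one_iff.2 (by linarith)
      linarith
    calc t ≤ Real.exp t * (1 - Real.exp (-t)) := by rw [mul_sub, h2]; linarith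
      _ ≤ _ := mul_le_mul h3 h4 h5 (Real.exp_pos C).le

lemma integrable_negPhi {φ : EucSp d → EReal} {z B : ℝ} (h : LAHT φ z B) (hz : 0 < z)
    (hφ : IsPairPotential φ) : Integrable (negPhi φ) := by
  refine (h.integrable hz hφ.meas).mono' (measurable_negPhi hφ.meas).aestronglyMeasurable
    (ae_of_all _ fun u => ?_)
  rw [Real.norm_of_nonneg (negPhi_nonneg _ _), negPhi]
  by_cases hu : φ u = ⊤
  · simp [hu]
  · rw [rexp_neg_of_ne_top hu (hφ.ne_bot u)]
    exact neg_max_le_abs_exp _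

lemma summable_config_of_hasCompactSupport {f : EucSp d → ℝ} (hf : HasCompactSupport f)
    (γ : Config d) : Summable fun y : γ.1 => f y.1 := by
  refine summable_of_hasFiniteSupport (Set.Finite.subset
    ((γ.2 (tsupport f) hf).preimage Subtype.val_injective.injOn) fun y hy => ?_)
  exact ⟨y.2, subset_tsupport f hy⟩

variable {s z B ξ : ℝ} {φ : EucSp d → EReal} {μ : Measure (Config d)}
  {k u : ∀ n : ℕ, (Fin n → EucSp d) → ℝ}

lemma Setting.ae_notMem_and_energy_ne_top (hset : Setting d s z B ξ φ μ k u) (x : EucSp d) :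
    ∀ᵐ γ ∂μ, x ∉ γ.1 ∧ energy φ x γ.1 ≠ ⊤ := by
  obtain ⟨R, C, hRC⟩ := hset.bddOutside
  set h1 : EucSp d → ℝ≥0∞ := fun y =>
    if R ≤ ‖x - y‖ then ‖(φ (x - y)).toReal‖ₑ else 0 with hh1
  have hsub : Measurable fun y : EucSp d => x - y := measurable_const.sub measurable_id
  have h1m : Measurable h1 := Measurable.ite
    (measurableSet_le measurable_const hsub.norm) (hset.pp.meas.comp hsub).ereal_toReal.enorm
    measurable_const
  have h1i : ∫⁻ y, h1 y < ∞ := by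
    have hle : ∀ y, h1 y ≤
        (fun v => ENNReal.ofReal (Real.exp C * |rexp (-(φ v)) - 1|)) (x - y) := fun y => by
      simp only [hh1]
      split_ifs with hy
      · obtain ⟨r, hr, hrC⟩ := hRC _ hy
        rw [hr, ← EReal.coe_neg, rexp_coe, EReal.toReal_coe, ← ofReal_norm]
        exact ENNReal.ofReal_le_ofReal (abs_le_exp_mul_abs_exp hrC)
      · exact zero_le
    refine (lintegral_mono hle).trans_lt ?_
    refine (lintegral_sub_left_eq_self
      (fun v => ENNReal.ofReal (Real.exp C * |rexp (-(φ v)) - 1|)) x).trans_lt ?_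
    exact ((hset.laht.integrable hset.hz hset.pp.meas).const_mul _).lintegral_lt_top
  have a1 : ∀ᵐ γ ∂μ, ∑' y : γ.1, h1 y.1 < ∞ :=
    ae_lt_top (measurable_tsum_config (g := fun _ => h1) measurable_id (h1m.comp measurable_snd))
      ((lintegral_tsum_le hset.corr hset.ruelle h1m).trans_lt
        (ENNReal.mul_lt_top ENNReal.ofReal_lt_top h1i)).ne
  have h2m : Measurable (({x} : Set (EucSp d)).indicator (1 : EucSp d → ℝ≥0∞)) :=
    measurable_one.indicator (measurableSet_singleton x)
  have a2 : ∀ᵐ γ ∂μ, ∑' y : γ.1, ({x} : Set (EucSp d)).indicator (1 : EucSp d → ℝ≥0∞) y.1 = 0 := by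
    have hm := measurable_tsum_config
      (g := fun (_ : Config d) => ({x} : Set (EucSp d)).indicator (1 : EucSp d → ℝ≥0∞))
      measurable_id (h2m.comp measurable_snd)
    refine (lintegral_eq_zero_iff hm).1 (le_antisymm ?_ zero_le)
    refine (lintegral_tsum_le hset.corr hset.ruelle h2m).trans ?_
    have : Nonempty (Fin d) := ⟨⟨0, hset.hd⟩⟩
    rw [lintegral_indicator_one (measurableSet_singleton x)]
    simp
  filter_upwards [a1, a2] with γ g1 g2
  have hx : x ∉ γ.1 := fun hx => by
    have := ENNReal.tsum_eq_zero.1 g2 ⟨x, hx⟩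
    simp at this
  refine ⟨hx, energy_ne_top_iff.2 ⟨fun y hy => hset.pp.finite_off _ fun e => hx ?_, ?_⟩⟩
  · rwa [sub_eq_zero.1 e]
  · have s1 : Summable fun y : γ.1 =>
        if R ≤ ‖x - y.1‖ then (φ (x - y.1)).toReal else 0 := by
      rw [← tsum_enorm_ne_top_iff]
      convert g1.ne using 3 with y
      simp only [hh1]
      split_ifs <;> simp
    have s2 : Summable fun y : γ.1 =>
        if R ≤ ‖x - y.1‖ then 0 else (φ (x - y.1)).toReal := by
      refine summable_of_hasFiniteSupport (Set.Finite.subset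
        ((γ.2 (Metric.closedBall x R) (isCompact_closedBall x R)).preimage
          Subtype.val_injective.injOn) fun y hy => ⟨y.2, ?_⟩)
      by_contra hc
      rw [Metric.mem_closedBall', dist_eq_norm, not_le] at hc
      exact hy (if_pos hc.le)
    convert s1.add s2 using 2 with y
    split_ifs <;> simp

lemma mul_energy_le_tsum_negPhi {x : EucSp d} {γ : Config d} (h : energy φ x γ.1 ≠ ⊤) {c : ℝ}
    (hc : c ∈ Icc (-1 : ℝ) 0) :
    Summable (fun y : γ.1 => negPhi φ (x - y.1)) ∧
      c * (energy φ x γ.1).toReal ≤ ∑' y : γ.1, negPhi φ (x - y.1) := by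
  have hs := (energy_ne_top_iff.1 h).2
  have hn : Summable (fun y : γ.1 => negPhi φ (x - y.1)) :=
    Summable.of_nonneg_of_le (fun y => negPhi_nonneg _ _)
      (fun y => max_le (neg_le_abs _) (abs_nonneg _)) hs.abs
  refine ⟨hn, ?_⟩
  rw [energy_eq_coe_tsum h, EReal.toReal_coe, ← tsum_mul_left]
  refine (hs.mul_left c).tsum_le_tsum (fun y => ?_) hn
  have h0 := negPhi_nonneg φ (x - y.1)
  have h1 : -(φ (x - y.1)).toReal ≤ negPhi φ (x - y.1) := le_max_left _ _
  rcases le_total 0 (φ (x - y.1)).toReal with h2 | h2 <;> nlinarith [hc.1, hc.2]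

lemma Setting.exists_lintegral_rexp_le (hset : Setting d s z B ξ φ μ k u) {f : EucSp d → ℝ}
    (hf : IsC0 f) :
    ∃ K : ℝ, ∀ c ∈ Icc (-1 : ℝ) 0, ∀ c' ∈ Icc (-1 : ℝ) 0, ∀ c'' ∈ Icc (-1 : ℝ) 0,
      ∀ x x' x'' : EucSp d,
        ∫⁻ γ, ENNReal.ofReal (rexp ((c : EReal) * energy φ x γ.1 + (c' : EReal) * energy φ x' γ.1
          + (c'' : EReal) * energy φ x'' γ.1 + ((2 * cpair f γ : ℝ) : EReal))) ∂μ
          ≤ ENNReal.ofReal K := by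
  obtain ⟨M, hM0, hM⟩ := exists_negPhi_le hset.stable hset.pp
  have hni := integrable_negPhi hset.laht hset.hz hset.pp
  set F : EucSp d → ℝ := fun y => 2 * max (f y) 0 with hF
  have hFc : Continuous F := continuous_const.mul (hf.1.max continuous_const)
  have hFs : HasCompactSupport F := hf.2.mono fun y hy hfy => hy (by simp [hF, hfy])
  have hF0 : ∀ y, 0 ≤ F y := fun y => by positivity
  obtain ⟨N, hN⟩ := hFs.exists_bound_of_continuous hFc
  have hFi : Integrable F := hFc.integrable_of_hasCompactSupport hFs
  set L := M + M + M + N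
  set J := Real.exp L * (3 * ∫ y, negPhi φ y) + Real.exp L * ∫ y, F y
  refine ⟨Real.exp (ξ * J), fun c hc c' hc' c'' hc'' x x' x'' => ?_⟩
  set ψ : EucSp d → ℝ := fun y =>
    negPhi φ (x - y) + negPhi φ (x' - y) + negPhi φ (x'' - y) + F y with hψ
  have hψ0 : ∀ y, 0 ≤ ψ y := fun y => by
    have := negPhi_nonneg φ (x - y)
    have := negPhi_nonneg φ (x' - y)
    have := negPhi_nonneg φ (x'' - y)
    have := hF0 y
    positivity
  have hψL : ∀ y, ψ y ≤ L := fun y => by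
    have := (le_abs_self _).trans (hN y)
    have := hM (x - y)
    have := hM (x' - y)
    have := hM (x'' - y)
    simp only [hψ, L]
    linarith
  have hnm := measurable_negPhi hset.pp.meas
  have hψm : Measurable ψ := by
    have : Measurable F := hFc.measurable
    fun_prop
  have n1 : Integrable fun y => negPhi φ (x - y) := hni.comp_sub_left x
  have n2 : Integrable fun y => negPhi φ (x - y) + negPhi φ (x' - y) :=
    n1.add (hni.comp_sub_left x')
  have n3 : Integrable fun y => negPhi φ (x - y) + negPhi φ (x' - y) + negPhi φ (x'' - y) :=
    n2.add (hni.comp_sub_left x'')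
  have hψi : Integrable ψ := n3.add hFi
  have hle : ∀ y, Real.exp (ψ y) - 1 ≤ Real.exp L * ψ y := fun y => by
    have h1 : 1 - ψ y ≤ Real.exp (-ψ y) := Real.one_sub_le_exp_neg _
    have h2 : Real.exp (ψ y) * Real.exp (-ψ y) = 1 := by rw [← Real.exp_add]; simp
    have h3 : Real.exp (ψ y) ≤ Real.exp L := Real.exp_le_exp.2 (hψL y)
    nlinarith [hψ0 y, Real.exp_pos (ψ y)]
  have hei : Integrable fun y => Real.exp (ψ y) - 1 := by
    refine (hψi.const_mul (Real.exp L)).mono'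
      ((Real.measurable_exp.comp hψm).sub_const 1).aestronglyMeasurable (ae_of_all _ fun y => ?_)
    rw [Real.norm_of_nonneg (sub_nonneg.2 (Real.one_le_exp (hψ0 y)))]
    exact hle y
  have hJ : ∫ y, (Real.exp (ψ y) - 1) ≤ J := by
    refine (integral_mono hei (hψi.const_mul (Real.exp L)) hle).trans (le_of_eq ?_)
    simp only [hψ]
    rw [integral_const_mul, integral_add n3 hFi, integral_add n2 (hni.comp_sub_left x''),
      integral_add n1 (hni.comp_sub_left x'),
      integral_sub_left_eq_self, integral_sub_left_eq_self, integral_sub_left_eq_self]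
    ring
  have := hset.prob
  calc _ ≤ ∫⁻ γ, ENNReal.ofReal (Real.exp (∑' y : γ.1, ψ y.1)) ∂μ := by
        refine lintegral_mono_ae ?_
        filter_upwards [hset.ae_notMem_and_energy_ne_top x, hset.ae_notMem_and_energy_ne_top x',
          hset.ae_notMem_and_energy_ne_top x''] with γ h h' h''
        obtain ⟨s1, t1⟩ := mul_energy_le_tsum_negPhi h.2 hc
        obtain ⟨s2, t2⟩ := mul_energy_le_tsum_negPhi h'.2 hc'
        obtain ⟨s3, t3⟩ := mul_energy_le_tsum_negPhi h''.2 hc''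
        have s4 := summable_config_of_hasCompactSupport hFs γ
        have t4 : 2 * cpair f γ ≤ ∑' y : γ.1, F y.1 := by
          rw [cpair, ← tsum_mul_left]
          refine ((summable_config_of_hasCompactSupport hf.2 γ).mul_left 2).tsum_le_tsum
            (fun y => ?_) s4
          exact mul_le_mul_of_nonneg_left (le_max_left _ _) zero_le_two
        rw [energy_eq_coe_toReal h.2, energy_eq_coe_toReal h'.2, energy_eq_coe_toReal h''.2]
        simp only [← EReal.coe_mul, ← EReal.coe_add, rexp_coe]
        refine ENNReal.ofReal_le_ofReal (Real.exp_le_exp.2 ?_)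
        simp only [hψ]
        rw [((s1.add s2).add s3).tsum_add s4, (s1.add s2).tsum_add s3, s1.tsum_add s2]
        linarith
    _ ≤ _ := lintegral_exp_tsum_le hset.hξ hset.corr hset.ruelle hψ0 hψm hei
    _ ≤ _ := ENNReal.ofReal_le_ofReal (Real.exp_le_exp.2 (by
        exact mul_le_mul_of_nonneg_left hJ hset.hξ.le))

end Energy

section Campbell

variable {d : ℕ}

lemma Config.del_ins (γ : Config d) (x : EucSp d) : (γ.ins x).del x = γ.del x := by
  apply Subtype.ext
  simp [Config.ins, Config.del]

/-- The Papangelou intensity `z exp(-E(x,γ))`. -/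
def papangelou (z : ℝ) (φ : EucSp d → EReal) (γ : Config d) (x : EucSp d) : ℝ≥0∞ :=
  ENNReal.ofReal z * eexp (-(energy φ x γ.1))

lemma measurable_papangelou {X : Type*} [MeasurableSpace X] {z : ℝ} {φ : EucSp d → EReal}
    (hφ : Measurable φ) {c : X → Config d} (hc : Measurable c) {x : X → EucSp d}
    (hx : Measurable x) : Measurable fun p => papangelou z φ (c p) (x p) :=
  (measurable_eexp.comp (measurable_energy hφ hc hx).neg).const_mul _

lemma papangelou_lt_top (z : ℝ) (φ : EucSp d → EReal) (γ : Config d) (x : EucSp d) :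
    papangelou z φ γ x < ∞ :=
  ENNReal.mul_lt_top ENNReal.ofReal_lt_top (eexp_neg_lt_top (energy_ne_bot φ x γ.1))

/-- The Papangelou intensity of an ordered pair of distinct points. -/
def papangelou₂ (z : ℝ) (φ : EucSp d → EReal) (γ : Config d) (x : EucSp d × EucSp d) : ℝ≥0∞ :=
  papangelou z φ γ x.2 * if x.2 = x.1 then 0 else papangelou z φ (γ.ins x.2) x.1

lemma measurable_papangelou₂ {z : ℝ} {φ : EucSp d → EReal} (hφ : Measurable φ) :
    Measurable fun p : Config d × (EucSp d × EucSp d) => papangelou₂ z φ p.1 p.2 := by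
  have h1 : Measurable fun p : Config d × (EucSp d × EucSp d) => p.2.1 := by fun_prop
  have h2 : Measurable fun p : Config d × (EucSp d × EucSp d) => p.2.2 := by fun_prop
  exact (measurable_papangelou hφ measurable_fst h2).mul
    (Measurable.ite (measurableSet_eq_fun h2 h1) measurable_const
      (measurable_papangelou hφ (measurable_ins measurable_fst h2) h1))

lemma papangelou₂_lt_top (z : ℝ) (φ : EucSp d → EReal) (γ : Config d) (x : EucSp d × EucSp d) :
    papangelou₂ z φ γ x < ∞ := by
  refine ENNReal.mul_lt_top (papangelou_lt_top z φ γ x.2) ?_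
  split_ifs
  · exact ENNReal.zero_lt_top
  · exact papangelou_lt_top z φ _ _

/-- The measure `∑_{x ∈ γ} ∑_{y ∈ γ} δ_{(γ,(x,y))}` averaged over `μ`. -/
def pairMeasure (μ : Measure (Config d)) : Measure (Config d × (EucSp d × EucSp d)) :=
  μ ⊗ₘ (pointKernel d ×ₖ pointKernel d)

lemma lintegral_pairMeasure (μ : Measure (Config d)) [SFinite μ]
    {h : Config d × (EucSp d × EucSp d) → ℝ≥0∞} (hh : Measurable h) :
    ∫⁻ p, h p ∂(pairMeasure μ) = ∫⁻ γ, ∑' x : γ.1, ∑' y : γ.1, h (γ, (x.1, y.1)) ∂μ := by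
  rw [pairMeasure, Measure.lintegral_compProd hh]
  refine lintegral_congr fun γ => ?_
  rw [Kernel.prod_apply, lintegral_prod _ (by fun_prop)]
  simp_rw [pointKernel_apply, lintegral_pointMeasure]

lemma measurable_ins_diag :
    Measurable fun p : Config d × EucSp d => (p.1.ins p.2, (p.2, p.2)) :=
  (measurable_ins measurable_fst measurable_snd).prodMk
    (measurable_snd.prodMk measurable_snd)

lemma measurable_ins_ins : Measurable fun p : Config d × (EucSp d × EucSp d) =>
    ((p.1.ins p.2.2).ins p.2.1, p.2) := by
  have h1 : Measurable fun p : Config d × (EucSp d × EucSp d) => p.2.1 := by fun_prop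
  have h2 : Measurable fun p : Config d × (EucSp d × EucSp d) => p.2.2 := by fun_prop
  exact (measurable_ins (measurable_ins measurable_fst h2) h1).prodMk measurable_snd

/-- The second-order Mecke formula for Gibbs measures. -/
lemma GNZ.pairMeasure_eq {z : ℝ} {φ : EucSp d → EReal} {μ : Measure (Config d)} [SFinite μ]
    (h : GNZ z φ μ) (hφ : Measurable φ) :
    pairMeasure μ =
      ((μ.prod volume).withDensity fun p => papangelou z φ p.1 p.2).map
          (fun p => (p.1.ins p.2, (p.2, p.2)))
        + ((μ.prod (volume.prod volume)).withDensity fun p => papangelou₂ z φ p.1 p.2).map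
          (fun p => ((p.1.ins p.2.2).ins p.2.1, p.2)) := by
  refine Measure.ext_of_lintegral _ fun g hg => ?_
  have hρ1 : Measurable fun p : Config d × EucSp d => papangelou z φ p.1 p.2 :=
    measurable_papangelou hφ measurable_fst measurable_snd
  have hg1 : Measurable fun p : Config d × EucSp d => g (p.1.ins p.2, (p.2, p.2)) :=
    hg.comp measurable_ins_diag
  have hg2 : Measurable fun p : Config d × (EucSp d × EucSp d) =>
      g ((p.1.ins p.2.2).ins p.2.1, p.2) := hg.comp measurable_ins_ins
  rw [lintegral_pairMeasure μ hg, lintegral_add_measure, lintegral_map hg measurable_ins_diag,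
    lintegral_map hg measurable_ins_ins,
    lintegral_withDensity_eq_lintegral_mul _ hρ1 hg1,
    lintegral_withDensity_eq_lintegral_mul _ (measurable_papangelou₂ hφ) hg2,
    lintegral_prod _ (hρ1.mul hg1).aemeasurable,
    lintegral_prod _ ((measurable_papangelou₂ hφ).mul hg2).aemeasurable]
  have hsplit : ∀ γ : Config d, ∑' x : γ.1, ∑' y : γ.1, g (γ, (x.1, y.1))
      = ∑' x : γ.1, g (γ, (x.1, x.1)) + ∑' x : γ.1, ∑' y : (γ.del x.1).1, g (γ, (x.1, y.1)) := by
    intro γ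
    rw [← ENNReal.tsum_add]
    refine tsum_congr fun x => ?_
    rw [← tsum_ins γ x.1 fun y => g (γ, (x.1, y))]
    have : γ.ins x.1 = γ := Subtype.ext (insert_eq_of_mem x.2)
    rw [this]
  have hm1 : Measurable (Function.uncurry fun (γ : Config d) (x : EucSp d) => g (γ, (x, x))) :=
    hg.comp (measurable_fst.prodMk (measurable_snd.prodMk measurable_snd))
  have hm2 : Measurable (Function.uncurry fun (γ : Config d) (x : EucSp d) =>
      ∑' y : (γ.del x).1, g (γ, (x, y.1))) := by
    refine measurable_tsum_config (X := Config d × EucSp d)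
      (g := fun p y => g (p.1, (p.2, y))) (measurable_del measurable_fst measurable_snd) ?_
    exact hg.comp (by fun_prop)
  simp_rw [hsplit]
  have hm : Measurable fun γ : Config d => ∑' x : γ.1, g (γ, (x.1, x.1)) :=
    measurable_tsum_config measurable_id hm1
  rw [lintegral_add_left hm]
  refine (congrArg₂ (· + ·) (h _ hm1) (h _ hm2)).trans ?_
  refine congrArg₂ (· + ·) rfl ?_
  have hm3 : Measurable (Function.uncurry fun (x : EucSp d) (γ : Config d) =>
      papangelou z φ γ x * ∑' y : (γ.del x).1, g (γ.ins x, (x, y.1))) := by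
    refine (measurable_papangelou hφ measurable_snd measurable_fst).mul ?_
    refine measurable_tsum_config (X := EucSp d × Config d)
      (g := fun p y => g (p.2.ins p.1, (p.1, y))) (measurable_del measurable_snd measurable_fst) ?_
    exact hg.comp (((measurable_ins measurable_snd measurable_fst).comp measurable_fst).prodMk
      (by fun_prop))
  calc _ = ∫⁻ γ, ∫⁻ x, papangelou z φ γ x * ∑' y : (γ.del x).1, g (γ.ins x, (x, y.1)) ∂volume ∂μ := by
        refine lintegral_congr fun γ => lintegral_congr fun x => ?_
        exact congrArg (fun c : Config d => papangelou z φ γ x *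
          ∑' y : c.1, g (γ.ins x, (x, y.1))) (γ.del_ins x)
    _ = ∫⁻ x, ∫⁻ γ, papangelou z φ γ x * ∑' y : (γ.del x).1, g (γ.ins x, (x, y.1)) ∂μ ∂volume :=
        (lintegral_lintegral_swap hm3.aemeasurable).symm
    _ = ∫⁻ x, ∫⁻ γ, ∫⁻ y, papangelou₂ z φ γ (x, y) *
          g ((γ.ins y).ins x, (x, y)) ∂volume ∂μ ∂volume := by
        refine lintegral_congr fun x => ?_
        have hm4 : Measurable (Function.uncurry fun (γ : Config d) (y : EucSp d) =>
            papangelou z φ γ x * if y = x then 0 else g (γ.ins x, (x, y))) := by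
          refine (measurable_papangelou hφ measurable_fst measurable_const).mul
            (Measurable.ite (measurableSet_eq_fun measurable_snd measurable_const)
              measurable_const ?_)
          exact hg.comp ((measurable_ins measurable_fst measurable_const).prodMk (by fun_prop))
        have hdel : ∀ γ : Config d,
            papangelou z φ γ x * ∑' y : (γ.del x).1, g (γ.ins x, (x, y.1)) =
              ∑' y : γ.1, papangelou z φ γ x * if y.1 = x then 0 else g (γ.ins x, (x, y.1)) :=
          fun γ => by
            rw [ENNReal.tsum_mul_left]
            exact congrArg _ (tsum_del γ x fun y => g (γ.ins x, (x, y)))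
        refine (lintegral_congr hdel).trans ((h _ hm4).trans ?_)
        refine lintegral_congr fun γ => lintegral_congr fun y => ?_
        rw [papangelou₂]
        simp only [papangelou]
        split_ifs
        · simp
        · ring
    _ = ∫⁻ γ, ∫⁻ x, ∫⁻ y, papangelou₂ z φ γ (x, y) *
          g ((γ.ins y).ins x, (x, y)) ∂volume ∂volume ∂μ := by
        refine lintegral_lintegral_swap (Measurable.aemeasurable ?_)
        refine Measurable.lintegral_prod_right' (f := fun p : (EucSp d × Config d) × EucSp d =>
          papangelou₂ z φ p.1.2 (p.1.1, p.2) * g ((p.1.2.ins p.2).ins p.1.1, (p.1.1, p.2))) ?_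
        exact ((measurable_papangelou₂ hφ).mul hg2).comp
          (f := fun p : (EucSp d × Config d) × EucSp d => (p.1.2, (p.1.1, p.2))) (by fun_prop)
    _ = _ := by
        refine lintegral_congr fun γ => ?_
        refine (lintegral_prod (fun x : EucSp d × EucSp d => papangelou₂ z φ γ x *
          g ((γ.ins x.2).ins x.1, x)) ?_).symm
        exact (((measurable_papangelou₂ hφ).mul hg2).comp
          measurable_prodMk_left).aemeasurable

end Campbell

section Interchange

variable {d : ℕ}

/-- Fubini for integrands that are, almost everywhere, a coefficient times a nonnegative function
of the configuration with uniformly bounded mean. -/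
lemma integral_prod_integral_eq {X : Type*} [MeasurableSpace X] {μ : Measure (Config d)}
    [SFinite μ] {ν : Measure X} [SFinite ν] {Φ : Config d × X → EucSp d → ℝ}
    (hm : Measurable (Function.uncurry Φ)) {c b : X × EucSp d → ℝ} {e : X × EucSp d → Config d → ℝ}
    {K : ℝ} (hb : Integrable b (ν.prod volume)) (hcb : ∀ᵐ p ∂ν.prod volume, |c p| ≤ b p)
    (he : ∀ p γ, 0 ≤ e p γ) (hK : ∀ p, ∫⁻ γ, ENNReal.ofReal (e p γ) ∂μ ≤ ENNReal.ofReal K)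
    (hΦ : ∀ᵐ p ∂ν.prod volume, ∀ᵐ γ ∂μ, Φ (γ, p.1) p.2 = c p * e p γ) :
    Integrable (fun q => ∫ y, Φ q y) (μ.prod ν) ∧
      Integrable (fun p => c p * ∫ γ, e p γ ∂μ) (ν.prod volume) ∧
      ∫ q, (∫ y, Φ q y) ∂(μ.prod ν) = ∫ p, c p * ∫ γ, e p γ ∂μ ∂(ν.prod volume) := by
  set S : (Config d × X) × EucSp d ≃ᵐ (X × EucSp d) × Config d :=
    MeasurableEquiv.prodAssoc.trans MeasurableEquiv.prodComm with hS
  have hSp : MeasurePreserving S ((μ.prod ν).prod volume) ((ν.prod volume).prod μ) :=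
    (measurePreserving_prodAssoc μ ν volume).trans Measure.measurePreserving_swap
  set Ψ : (X × EucSp d) × Config d → ℝ := fun r => Φ (r.2, r.1.1) r.1.2 with hΨ
  have hΨm : Measurable Ψ :=
    hm.comp (f := fun r : (X × EucSp d) × Config d => ((r.2, r.1.1), r.1.2)) (by fun_prop)
  have hΨi : Integrable Ψ ((ν.prod volume).prod μ) := by
    refine ⟨hΨm.aestronglyMeasurable, ?_⟩
    rw [hasFiniteIntegral_iff_enorm, lintegral_prod _ hΨm.enorm.aemeasurable]
    calc _ ≤ ∫⁻ p, ENNReal.ofReal (b p) * ENNReal.ofReal K ∂(ν.prod volume) := by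
          refine lintegral_mono_ae ?_
          filter_upwards [hcb, hΦ] with p h1 h2
          calc ∫⁻ γ, ‖Ψ (p, γ)‖ₑ ∂μ
              = ∫⁻ γ, ENNReal.ofReal |c p| * ENNReal.ofReal (e p γ) ∂μ := by
                refine lintegral_congr_ae (h2.mono fun γ hγ => ?_)
                change ‖Φ (γ, p.1) p.2‖ₑ = _
                rw [hγ, enorm_mul, ← ofReal_norm, ← ofReal_norm, Real.norm_eq_abs,
                  Real.norm_of_nonneg (he p γ)]
            _ ≤ _ := by
                rw [lintegral_const_mul' _ _ ENNReal.ofReal_ne_top]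
                exact mul_le_mul' (ENNReal.ofReal_le_ofReal h1) (hK p)
      _ < ∞ := by
          rw [lintegral_mul_const' _ _ ENNReal.ofReal_ne_top]
          exact ENNReal.mul_lt_top hb.lintegral_lt_top ENNReal.ofReal_lt_top
  have hΦi : Integrable (Function.uncurry Φ) ((μ.prod ν).prod volume) :=
    hSp.integrable_comp_of_integrable hΨi
  have hcongr : (fun p => ∫ γ, Ψ (p, γ) ∂μ) =ᵐ[ν.prod volume] fun p => c p * ∫ γ, e p γ ∂μ :=
    hΦ.mono fun p hp => by
      beta_reduce
      rw [← integral_const_mul]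
      exact integral_congr_ae hp
  refine ⟨hΦi.integral_prod_left, hΨi.integral_prod_left.congr hcongr, ?_⟩
  rw [← integral_congr_ae hcongr, ← integral_prod _ hΨi, ← hSp.integral_comp' Ψ]
  exact (integral_prod _ hΦi).symm

end Interchange

section Insertion

variable {d : ℕ}

lemma hasSum_ins {γ : Config d} {x : EucSp d} (hx : x ∉ γ.1) {g : EucSp d → ℝ} {S : ℝ}
    (h : HasSum (fun y : γ.1 => g y.1) S) :
    HasSum (fun y : (γ.ins x).1 => g y.1) (g x + S) := by
  have h1 : HasSum (fun y : ({x} : Set (EucSp d)) => g y.1) (g x) :=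
    hasSum_unique fun y : ({x} : Set (EucSp d)) => g y.1
  exact HasSum.add_disjoint (f := g) (disjoint_singleton_left.2 hx) h1 h

lemma cpair_ins {f : EucSp d → ℝ} (hf : HasCompactSupport f) {γ : Config d} {x : EucSp d}
    (hx : x ∉ γ.1) : cpair f (γ.ins x) = f x + cpair f γ :=
  (hasSum_ins hx (summable_config_of_hasCompactSupport hf γ).hasSum).tsum_eq

lemma Config.ins_del {γ : Config d} {x : EucSp d} (hx : x ∈ γ.1) : (γ.del x).ins x = γ :=
  Subtype.ext (insert_sdiff_self_of_mem hx)

lemma Config.del_eq_self {γ : Config d} {x : EucSp d} (hx : x ∉ γ.1) : γ.del x = γ :=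
  Subtype.ext (sdiff_singleton_eq_self hx)

lemma Config.notMem_del (γ : Config d) (x : EucSp d) : x ∉ (γ.del x).1 := fun h => h.2 rfl

lemma Config.notMem_ins {γ : Config d} {x y : EucSp d} (hxy : x ≠ y) (hx : x ∉ γ.1) :
    x ∉ (γ.ins y).1 := fun h => h.elim hxy hx

lemma energy_ins {φ : EucSp d → EReal} (hφ : IsPairPotential φ) {γ : Config d} {x y : EucSp d}
    (hx : x ∉ γ.1) (hxy : y ≠ x) (h : energy φ y γ.1 ≠ ⊤) :
    energy φ y (γ.ins x).1 = energy φ y γ.1 + φ (y - x) := by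
  have h' := energy_ne_top_iff.1 h
  have hs := hasSum_ins (g := fun v => (φ (y - v)).toReal) hx h'.2.hasSum
  have hφx := hφ.finite_off _ (sub_ne_zero.2 hxy)
  have hn : energy φ y (γ.ins x).1 ≠ ⊤ := by
    refine energy_ne_top_iff.2 ⟨fun v hv => ?_, hs.summable⟩
    rcases hv with rfl | hv
    · exact hφx
    · exact h'.1 v hv
  rw [energy_eq_coe_tsum hn, hs.tsum_eq, energy_eq_coe_tsum h,
    ← EReal.coe_toReal hφx (hφ.ne_bot _), ← EReal.coe_add, EReal.toReal_coe, add_comm]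

end Insertion

section Generators

variable {d : ℕ} {X : Type*} [MeasurableSpace X]

lemma integral_pointMeasure {γ : Config d} {g : EucSp d → ℝ} (hm : Measurable g)
    (hg : Summable fun x : γ.1 => g x.1) :
    ∫ x, g x ∂(pointMeasure γ) = ∑' x : γ.1, g x.1 := by
  have hi : Integrable g (Measure.sum fun x : γ.1 => Measure.dirac x.1) := by
    refine ⟨hm.aestronglyMeasurable, ?_⟩
    rw [hasFiniteIntegral_iff_enorm]
    exact (lintegral_pointMeasure γ fun x => ‖g x‖ₑ).trans_lt
      (tsum_enorm_ne_top_iff.2 hg).lt_top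
  refine (integral_sum_measure hi).trans (tsum_congr fun x => ?_)
  exact integral_dirac g x.1

/-- The death weight of a point `x` added to `γ`, for the exponential of a linear functional. -/
def deathWeight (s : ℝ) (φ : EucSp d → EReal) (f : EucSp d → ℝ) (γ : Config d) (x : EucSp d) : ℝ :=
  rexp ((s : EReal) * energy φ x γ.1) * (Real.exp (cpair f γ) * (1 - Real.exp (f x)))

/-- The weight of the removal of `x` from `γ ∪ {x}` along the jump to `ε⁻¹ y + x`. -/
def jumpWeight (s : ℝ) (φ : EucSp d → EReal) (f a : EucSp d → ℝ) (ε : ℝ) (γ : Config d)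
    (x y : EucSp d) : ℝ :=
  Real.exp (cpair f γ) * (1 - Real.exp (f x)) *
    (a y * rexp ((s : EReal) * energy φ x γ.1 +
      ((s - 1 : ℝ) : EReal) * energy φ (ε⁻¹ • y + x) γ.1))

lemma measurable_deathWeight {s : ℝ} {φ : EucSp d → EReal} (hφ : Measurable φ) {f : EucSp d → ℝ}
    (hf : Measurable f) {c : X → Config d} (hc : Measurable c) {x : X → EucSp d}
    (hx : Measurable x) : Measurable fun p => deathWeight s φ f (c p) (x p) := by
  have h1 := measurable_energy hφ hc hx
  have h2 := measurable_cpair hc hf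
  exact (measurable_rexp.comp (measurable_const.mul h1)).mul
    (h2.exp.mul (measurable_const.sub (hf.comp hx).exp))

lemma measurable_jumpWeight {s : ℝ} {φ : EucSp d → EReal} (hφ : Measurable φ) {f a : EucSp d → ℝ}
    (hf : Measurable f) (ha : Measurable a) (ε : ℝ) {c : X → Config d} (hc : Measurable c)
    {x y : X → EucSp d} (hx : Measurable x) (hy : Measurable y) :
    Measurable fun p => jumpWeight s φ f a ε (c p) (x p) (y p) := by
  have h1 := measurable_energy hφ hc hx
  have h2 := measurable_cpair hc hf
  have h3 := measurable_energy hφ hc ((hy.const_smul ε⁻¹).add hx)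
  exact (h2.exp.mul (measurable_const.sub (hf.comp hx).exp)).mul ((ha.comp hy).mul
    (measurable_rexp.comp ((measurable_const.mul h1).add (measurable_const.mul h3))))

lemma measurable_integral_jumpWeight {s : ℝ} {φ : EucSp d → EReal} (hφ : Measurable φ)
    {f a : EucSp d → ℝ} (hf : Measurable f) (ha : Measurable a) (ε : ℝ) {c : X → Config d}
    (hc : Measurable c) {x : X → EucSp d} (hx : Measurable x) :
    Measurable fun p => ∫ y, jumpWeight s φ f a ε (c p) (x p) y :=
  (measurable_jumpWeight (X := X × EucSp d) hφ hf ha ε (hc.comp measurable_fst)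
    (hx.comp measurable_fst) measurable_snd).stronglyMeasurable.integral_prod_right.measurable

lemma Dminus_exp_cpair {f : EucSp d → ℝ} (hf : HasCompactSupport f) {γ : Config d} {x : EucSp d}
    (hx : x ∈ γ.1) : Dminus (fun γ' => Real.exp (cpair f γ')) x γ =
      Real.exp (cpair f (γ.del x)) * (1 - Real.exp (f x)) := by
  have h := cpair_ins hf (γ.notMem_del x)
  rw [Config.ins_del hx] at h
  simp only [Dminus]
  rw [h, Real.exp_add]
  ring

lemma integral_aScaled_sub {a : EucSp d → ℝ} (ha : ∀ x, a (-x) = a x) {ε : ℝ} (hε : 0 < ε)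
    (g : EucSp d → ℝ) (x : EucSp d) :
    ∫ y, aScaled a ε (x - y) * g y = ∫ y, a y * g (ε⁻¹ • y + x) := by
  rw [← integral_add_right_eq_self (fun y => aScaled a ε (x - y) * g y) x]
  have h : ∀ y, aScaled a ε (x - (y + x)) * g (y + x) =
      ε ^ d * (fun v => a v * g (ε⁻¹ • v + x)) (ε • y) := fun y => by
    simp only [aScaled, sub_add_cancel_right, smul_neg, ha, inv_smul_smul₀ hε.ne']
    ring
  rw [integral_congr_ae (ae_of_all _ h), integral_const_mul,
    Measure.integral_comp_smul volume (fun v => a v * g (ε⁻¹ • v + x)) ε, finrank_euclideanSpace_fin,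
    abs_of_pos (by positivity), smul_eq_mul, ← mul_assoc, mul_inv_cancel₀ (by positivity), one_mul]

lemma H0Minus_exp_cpair {s : ℝ} {φ : EucSp d → EReal} {f : EucSp d → ℝ}
    (hf : HasCompactSupport f) (γ : Config d) :
    H0Minus s φ (fun γ' => Real.exp (cpair f γ')) γ =
      -∑' x : γ.1, deathWeight s φ f (γ.del x.1) x.1 := by
  rw [H0Minus]
  refine congrArg _ (tsum_congr fun x => ?_)
  rw [Dminus_exp_cpair hf x.2]
  rfl

lemma HepsMinus_exp_cpair {s ε : ℝ} {φ : EucSp d → EReal} {f a : EucSp d → ℝ}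
    (hf : HasCompactSupport f) (ha : ∀ x, a (-x) = a x) (hε : 0 < ε) (γ : Config d) :
    HepsMinus s (aScaled a ε) φ (fun γ' => Real.exp (cpair f γ')) γ =
      -∑' x : γ.1, ∫ y, jumpWeight s φ f a ε (γ.del x.1) x.1 y := by
  rw [HepsMinus]
  refine congrArg _ (tsum_congr fun x => ?_)
  rw [Dminus_exp_cpair hf x.2, integral_aScaled_sub ha hε (fun y =>
    rexp ((s : EReal) * energy φ x.1 (γ.1 \ {x.1}) +
      ((s - 1 : ℝ) : EReal) * energy φ y (γ.1 \ {x.1})))]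
  exact (integral_const_mul _ _).symm

/-- The product of the jump weight and the death weight of two points of a configuration. -/
def weightProd (s : ℝ) (φ : EucSp d → EReal) (f a : EucSp d → ℝ) (ε : ℝ)
    (p : Config d × (EucSp d × EucSp d)) : ℝ :=
  (∫ y, jumpWeight s φ f a ε (p.1.del p.2.1) p.2.1 y) *
    deathWeight s φ f (p.1.del p.2.2) p.2.2

lemma measurable_weightProd {s : ℝ} {φ : EucSp d → EReal} (hφ : Measurable φ) {f a : EucSp d → ℝ}
    (hf : Measurable f) (ha : Measurable a) (ε : ℝ) : Measurable (weightProd s φ f a ε) := by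
  have h1 : Measurable fun p : Config d × (EucSp d × EucSp d) => p.2.1 := by fun_prop
  have h2 : Measurable fun p : Config d × (EucSp d × EucSp d) => p.2.2 := by fun_prop
  exact (measurable_integral_jumpWeight hφ hf ha ε (measurable_del measurable_fst h1) h1).mul
    (measurable_deathWeight hφ hf (measurable_del measurable_fst h2) h2)

lemma H0Minus_mul_HepsMinus {s ε : ℝ} {φ : EucSp d → EReal} (hφ : Measurable φ)
    {f a : EucSp d → ℝ} (hf : IsC0 f) (ha : GoodA a) (hε : 0 < ε) (γ : Config d) :
    H0Minus s φ (fun γ' => Real.exp (cpair f γ')) γ *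
        HepsMinus s (aScaled a ε) φ (fun γ' => Real.exp (cpair f γ')) γ =
      ∫ x, weightProd s φ f a ε (γ, x) ∂((pointKernel d ×ₖ pointKernel d) γ) := by
  have hs : ∀ g : EucSp d → ℝ, (∀ x, f x = 0 → g x = 0) → Summable fun x : γ.1 => g x.1 :=
    fun g hg => summable_config_of_hasCompactSupport
      (hf.2.mono fun x hx hfx => hx (hg x hfx)) γ
  have hdel : Measurable fun x : EucSp d => γ.del x := measurable_del measurable_const measurable_id
  have hj : Measurable fun x => ∫ y, jumpWeight s φ f a ε (γ.del x) x y :=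
    measurable_integral_jumpWeight hφ hf.1.measurable ha.meas ε hdel measurable_id
  have hd : Measurable fun x => deathWeight s φ f (γ.del x) x :=
    measurable_deathWeight hφ hf.1.measurable hdel measurable_id
  have zj : ∀ x, f x = 0 → ∫ y, jumpWeight s φ f a ε (γ.del x) x y = 0 := fun x hx => by
    simp [jumpWeight, hx]
  have zd : ∀ x, f x = 0 → deathWeight s φ f (γ.del x) x = 0 := fun x hx => by
    simp [deathWeight, hx]
  rw [H0Minus_exp_cpair hf.2, HepsMinus_exp_cpair hf.2 ha.even hε, neg_mul_neg, mul_comm,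
    Kernel.prod_apply, pointKernel_apply, ← integral_pointMeasure hj (hs _ zj),
    ← integral_pointMeasure hd (hs _ zd), ← integral_prod_mul]
  rfl

lemma integral_pairMeasure_eq {z : ℝ} {φ : EucSp d → EReal} {μ : Measure (Config d)} [SFinite μ]
    (h : GNZ z φ μ) (hφ : Measurable φ) {g : Config d × (EucSp d × EucSp d) → ℝ}
    (hg : Measurable g)
    (h₁ : Integrable (fun p => (papangelou z φ p.1 p.2).toReal * g (p.1.ins p.2, (p.2, p.2)))
      (μ.prod volume))
    (h₂ : Integrable (fun p => (papangelou₂ z φ p.1 p.2).toReal *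
      g ((p.1.ins p.2.2).ins p.2.1, p.2)) (μ.prod (volume.prod volume))) :
    Integrable g (pairMeasure μ) ∧ ∫ p, g p ∂(pairMeasure μ) =
      ∫ p, (papangelou z φ p.1 p.2).toReal * g (p.1.ins p.2, (p.2, p.2)) ∂(μ.prod volume) +
        ∫ p, (papangelou₂ z φ p.1 p.2).toReal * g ((p.1.ins p.2.2).ins p.2.1, p.2)
          ∂(μ.prod (volume.prod volume)) := by
  have hρ1 : Measurable fun p : Config d × EucSp d => papangelou z φ p.1 p.2 :=
    measurable_papangelou hφ measurable_fst measurable_snd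
  have hρ2 := measurable_papangelou₂ (z := z) hφ
  have ht1 := ae_of_all (μ.prod volume) fun p : Config d × EucSp d =>
    papangelou_lt_top z φ p.1 p.2
  have ht2 := ae_of_all (μ.prod (volume.prod volume))
    fun p : Config d × (EucSp d × EucSp d) => papangelou₂_lt_top z φ p.1 p.2
  have i1 := (integrable_map_measure (g := g) hg.aestronglyMeasurable
    measurable_ins_diag.aemeasurable).2
      ((integrable_withDensity_iff_integrable_smul' hρ1 ht1).2 h₁)
  have i2 := (integrable_map_measure (g := g) hg.aestronglyMeasurable
    measurable_ins_ins.aemeasurable).2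
      ((integrable_withDensity_iff_integrable_smul' hρ2 ht2).2 h₂)
  rw [h.pairMeasure_eq hφ, integrable_add_measure]
  refine ⟨⟨i1, i2⟩, ?_⟩
  rw [integral_add_measure i1 i2,
    integral_map measurable_ins_diag.aemeasurable hg.aestronglyMeasurable,
    integral_map measurable_ins_ins.aemeasurable hg.aestronglyMeasurable,
    integral_withDensity_eq_integral_toReal_smul hρ1 ht1,
    integral_withDensity_eq_integral_toReal_smul hρ2 ht2]
  rfl

end Generators

section Evaluation

variable {d : ℕ} {s z B ξ ε : ℝ} {φ : EucSp d → EReal} {μ : Measure (Config d)}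
  {k u : ∀ n : ℕ, (Fin n → EucSp d) → ℝ} {f a : EucSp d → ℝ} {γ : Config d}

lemma toReal_papangelou (hz : 0 ≤ z) (γ : Config d) (x : EucSp d) :
    (papangelou z φ γ x).toReal = z * rexp (-(energy φ x γ.1)) := by
  rw [papangelou, ENNReal.toReal_mul, ENNReal.toReal_ofReal hz, rexp]

lemma papangelou_mul_weights (hz : 0 ≤ z) {x y : EucSp d} (hx : x ∉ γ.1)
    (hE : energy φ x γ.1 ≠ ⊤) (hE' : energy φ (ε⁻¹ • y + x) γ.1 ≠ ⊤) :
    (papangelou z φ γ x).toReal * (jumpWeight s φ f a ε ((γ.ins x).del x) x y *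
        deathWeight s φ f ((γ.ins x).del x) x) =
      z * (Real.exp (f x) - 1) ^ 2 * a y *
        rexp (((2 * s - 1 : ℝ) : EReal) * energy φ x γ.1 +
          ((s - 1 : ℝ) : EReal) * energy φ (ε⁻¹ • y + x) γ.1 +
          ((2 * cpair f γ : ℝ) : EReal)) := by
  rw [Config.del_ins, Config.del_eq_self hx, toReal_papangelou hz, jumpWeight, deathWeight,
    energy_eq_coe_toReal hE, energy_eq_coe_toReal hE']
  generalize (energy φ x γ.1).toReal = r
  generalize (energy φ (ε⁻¹ • y + x) γ.1).toReal = r'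
  generalize cpair f γ = t
  simp only [← EReal.coe_mul, ← EReal.coe_add, ← EReal.coe_neg, rexp_coe]
  have h : Real.exp ((2 * s - 1) * r + (s - 1) * r' + 2 * t) =
      Real.exp (-r) * Real.exp t * Real.exp (s * r + (s - 1) * r') * Real.exp (s * r) *
        Real.exp t := by
    simp only [← Real.exp_add]
    ring_nf
  rw [h]
  ring

lemma papangelou₂_mul_weights (hz : 0 ≤ z) (hφ : IsPairPotential φ) (hf : HasCompactSupport f)
    {x₁ x₂ y : EucSp d} (hx : x₁ ≠ x₂) (hy : ε⁻¹ • y + x₁ ≠ x₂) (hx₁ : x₁ ∉ γ.1) (hx₂ : x₂ ∉ γ.1)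
    (hE₁ : energy φ x₁ γ.1 ≠ ⊤) (hE₂ : energy φ x₂ γ.1 ≠ ⊤)
    (hE' : energy φ (ε⁻¹ • y + x₁) γ.1 ≠ ⊤) :
    (papangelou₂ z φ γ (x₁, x₂)).toReal *
        (jumpWeight s φ f a ε (((γ.ins x₂).ins x₁).del x₁) x₁ y *
          deathWeight s φ f (((γ.ins x₂).ins x₁).del x₂) x₂) =
      z * z * (Real.exp (f x₁) - 1) * (Real.exp (f x₂) - 1) *
          Real.exp (f x₁) * Real.exp (f x₂) * a y *
          rexp (((2 * s - 1 : ℝ) : EReal) * φ (x₁ - x₂) +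
            ((s - 1 : ℝ) : EReal) * φ (ε⁻¹ • y + x₁ - x₂)) *
        rexp (((s - 1 : ℝ) : EReal) * energy φ x₁ γ.1 +
          ((s - 1 : ℝ) : EReal) * energy φ x₂ γ.1 +
          ((s - 1 : ℝ) : EReal) * energy φ (ε⁻¹ • y + x₁) γ.1 +
          ((2 * cpair f γ : ℝ) : EReal)) := by
  have hcomm : (γ.ins x₂).ins x₁ = (γ.ins x₁).ins x₂ := Subtype.ext (Set.insert_comm _ _ _)
  have hsym : φ (x₂ - x₁) = φ (x₁ - x₂) := by
    rw [← neg_sub, hφ.even _ (sub_ne_zero.2 hx)]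
  rw [papangelou₂, if_neg hx.symm, ENNReal.toReal_mul, toReal_papangelou hz, toReal_papangelou hz,
    Config.del_ins, Config.del_eq_self (Config.notMem_ins hx hx₁), hcomm, Config.del_ins,
    Config.del_eq_self (Config.notMem_ins hx.symm hx₂), jumpWeight, deathWeight,
    cpair_ins hf hx₁, cpair_ins hf hx₂, energy_ins hφ hx₂ hx hE₁, energy_ins hφ hx₁ hx.symm hE₂,
    energy_ins hφ hx₂ hy hE', hsym, energy_eq_coe_toReal hE₁, energy_eq_coe_toReal hE₂,
    energy_eq_coe_toReal hE',
    ← EReal.coe_toReal (hφ.finite_off _ (sub_ne_zero.2 hx)) (hφ.ne_bot (x₁ - x₂)),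
    ← EReal.coe_toReal (hφ.finite_off _ (sub_ne_zero.2 hy)) (hφ.ne_bot (ε⁻¹ • y + x₁ - x₂))]
  generalize (energy φ x₁ γ.1).toReal = r₁
  generalize (energy φ x₂ γ.1).toReal = r₂
  generalize (energy φ (ε⁻¹ • y + x₁) γ.1).toReal = r'
  generalize (φ (x₁ - x₂)).toReal = v
  generalize (φ (ε⁻¹ • y + x₁ - x₂)).toReal = v'
  generalize cpair f γ = t
  simp only [← EReal.coe_mul, ← EReal.coe_add, ← EReal.coe_neg, rexp_coe]
  have h : Real.exp ((2 * s - 1) * v + (s - 1) * v') *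
        Real.exp ((s - 1) * r₁ + (s - 1) * r₂ + (s - 1) * r' + 2 * t) =
      Real.exp (-r₂) * Real.exp (-(r₁ + v)) * Real.exp t * Real.exp t *
        Real.exp (s * (r₁ + v) + (s - 1) * (r' + v')) * Real.exp (s * (r₂ + v)) := by
    simp only [← Real.exp_add]
    ring_nf
  rw [mul_assoc _ (Real.exp ((2 * s - 1) * v + (s - 1) * v')), h, Real.exp_add (f x₁),
    Real.exp_add (f x₂)]
  ring

lemma rexp_phi_le (hs : Stable φ B) (hB : 0 ≤ B) (hφ : IsPairPotential φ) {c c' : ℝ}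
    (hc : c ∈ Icc (-1 : ℝ) 0) (hc' : c' ∈ Icc (-1 : ℝ) 0) {x x' : EucSp d} (hx : x ≠ 0)
    (hx' : x' ≠ 0) :
    rexp ((c : EReal) * φ x + (c' : EReal) * φ x') ≤ Real.exp (2 * B + 2 * B) := by
  have h := hs.neg_le_toReal hφ hx
  have h' := hs.neg_le_toReal hφ hx'
  rw [← EReal.coe_toReal (hφ.finite_off _ hx) (hφ.ne_bot x),
    ← EReal.coe_toReal (hφ.finite_off _ hx') (hφ.ne_bot x')]
  simp only [← EReal.coe_mul, ← EReal.coe_add, rexp_coe]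
  refine Real.exp_le_exp.2 (add_le_add ?_ ?_)
  · nlinarith [hc.1, hc.2]
  · nlinarith [hc'.1, hc'.2]

lemma IsC0.integrable_exp_sub_one_mul_exp (hf : IsC0 f) :
    Integrable fun x => (Real.exp (f x) - 1) * Real.exp (f x) := by
  refine Continuous.integrable_of_hasCompactSupport
    (((Real.continuous_exp.comp hf.1).sub continuous_const).mul (Real.continuous_exp.comp hf.1))
    (hf.2.mono fun x hx hfx => hx ?_)
  simp [hfx]

lemma IsC0.integrable_exp_sub_one_sq (hf : IsC0 f) :
    Integrable fun x => (Real.exp (f x) - 1) ^ 2 := by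
  refine Continuous.integrable_of_hasCompactSupport
    (((Real.continuous_exp.comp hf.1).sub continuous_const).pow 2) (hf.2.mono fun x hx hfx => hx ?_)
  simp [hfx]

lemma Setting.volume_nullSingletonClass (hset : Setting d s z B ξ φ μ k u) :
    NullSingletonClass (volume : Measure (EucSp d)) := by
  have : Nonempty (Fin d) := ⟨⟨0, hset.hd⟩⟩
  infer_instance

/-- The contribution of coinciding points to the second moment. -/
lemma Setting.integral_papangelou_mul_weightProd (hset : Setting d s z B ξ φ μ k u)
    (ha : GoodA a) (hf : IsC0 f) :
    Integrable (fun p : Config d × EucSp d => (papangelou z φ p.1 p.2).toReal *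
        weightProd s φ f a ε (p.1.ins p.2, (p.2, p.2))) (μ.prod volume) ∧
      ∫ p : Config d × EucSp d, (papangelou z φ p.1 p.2).toReal *
          weightProd s φ f a ε (p.1.ins p.2, (p.2, p.2)) ∂(μ.prod volume) =
        ∫ x : EucSp d, ∫ y : EucSp d,
            z * (Real.exp (f x) - 1) ^ 2 * a y *
            ∫ γ, rexp (((2 * s - 1 : ℝ) : EReal) * energy φ x γ.1 +
              ((s - 1 : ℝ) : EReal) * energy φ (ε⁻¹ • y + x) γ.1 +
              ((2 * cpair f γ : ℝ) : EReal)) ∂μ := by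
  have := hset.prob
  have hfm := hf.1.measurable
  obtain ⟨K, hK⟩ := hset.exists_lintegral_rexp_le hf
  have hs1 := hset.hs1
  have hs0 := hset.hs0
  have m1 : Measurable fun r : (Config d × EucSp d) × EucSp d => r.1.1 := by fun_prop
  have m2 : Measurable fun r : (Config d × EucSp d) × EucSp d => r.1.2 := by fun_prop
  have md := measurable_del (measurable_ins m1 m2) m2
  obtain ⟨h1, h2, h3⟩ := integral_prod_integral_eq (μ := μ) (ν := (volume : Measure (EucSp d)))
    (Φ := fun q y => (papangelou z φ q.1 q.2).toReal *
      (jumpWeight s φ f a ε ((q.1.ins q.2).del q.2) q.2 y *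
        deathWeight s φ f ((q.1.ins q.2).del q.2) q.2))
    (c := fun p => z * (Real.exp (f p.1) - 1) ^ 2 * a p.2)
    (b := fun p => z * (Real.exp (f p.1) - 1) ^ 2 * a p.2)
    (e := fun p γ => rexp (((2 * s - 1 : ℝ) : EReal) * energy φ p.1 γ.1 +
      ((s - 1 : ℝ) : EReal) * energy φ (ε⁻¹ • p.2 + p.1) γ.1 + ((2 * cpair f γ : ℝ) : EReal)))
    (K := K)
    ((measurable_papangelou hset.pp.meas m1 m2).ennreal_toReal.mul
      ((measurable_jumpWeight hset.pp.meas hfm ha.meas ε md m2 measurable_snd).mul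
        (measurable_deathWeight hset.pp.meas hfm md m2)))
    ((hf.integrable_exp_sub_one_sq.const_mul z).mul_prod ha.int)
    (ae_of_all _ fun p => (abs_of_nonneg (mul_nonneg (mul_nonneg hset.hz.le (sq_nonneg _))
      (ha.nonneg _))).le)
    (fun _ _ => rexp_nonneg _)
    (fun p => by
      have := hK (2 * s - 1) ⟨by linarith, by linarith⟩ (s - 1) ⟨by linarith, by linarith⟩ 0
        ⟨by norm_num, le_rfl⟩ p.1 (ε⁻¹ • p.2 + p.1) 0
      simpa only [EReal.coe_zero, zero_mul, add_zero] using this)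
    (ae_of_all _ fun p => by
      filter_upwards [hset.ae_notMem_and_energy_ne_top p.1,
        hset.ae_notMem_and_energy_ne_top (ε⁻¹ • p.2 + p.1)] with γ hγ hγ'
      exact papangelou_mul_weights hset.hz.le hγ.1 hγ.2 hγ'.2)
  have hw : (fun p : Config d × EucSp d => (papangelou z φ p.1 p.2).toReal *
      weightProd s φ f a ε (p.1.ins p.2, (p.2, p.2))) = fun q => ∫ y,
        (papangelou z φ q.1 q.2).toReal * (jumpWeight s φ f a ε ((q.1.ins q.2).del q.2) q.2 y *
          deathWeight s φ f ((q.1.ins q.2).del q.2) q.2) := by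
    ext p
    rw [integral_const_mul, integral_mul_const, weightProd]
  rw [hw]
  exact ⟨h1, h3.trans (integral_prod _ h2)⟩

/-- The contribution of distinct points to the second moment. -/
lemma Setting.integral_papangelou₂_mul_weightProd (hset : Setting d s z B ξ φ μ k u)
    (ha : GoodA a) (hf : IsC0 f) (hε : 0 < ε) :
    Integrable (fun p : Config d × (EucSp d × EucSp d) => (papangelou₂ z φ p.1 p.2).toReal *
        weightProd s φ f a ε ((p.1.ins p.2.2).ins p.2.1, p.2)) (μ.prod (volume.prod volume)) ∧
      ∫ p : Config d × (EucSp d × EucSp d), (papangelou₂ z φ p.1 p.2).toReal *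
          weightProd s φ f a ε ((p.1.ins p.2.2).ins p.2.1, p.2) ∂(μ.prod (volume.prod volume)) =
        ∫ x₁ : EucSp d, ∫ x₂ : EucSp d, ∫ y : EucSp d,
            z * z * (Real.exp (f x₁) - 1) * (Real.exp (f x₂) - 1) *
              Real.exp (f x₁) * Real.exp (f x₂) * a y *
              rexp (((2 * s - 1 : ℝ) : EReal) * φ (x₁ - x₂) +
                ((s - 1 : ℝ) : EReal) * φ (ε⁻¹ • y + x₁ - x₂)) *
            ∫ γ, rexp (((s - 1 : ℝ) : EReal) * energy φ x₁ γ.1 +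
              ((s - 1 : ℝ) : EReal) * energy φ x₂ γ.1 +
              ((s - 1 : ℝ) : EReal) * energy φ (ε⁻¹ • y + x₁) γ.1 +
              ((2 * cpair f γ : ℝ) : EReal)) ∂μ := by
  have := hset.prob
  have := hset.volume_nullSingletonClass
  have hfm := hf.1.measurable
  obtain ⟨K, hK⟩ := hset.exists_lintegral_rexp_le hf
  have hs1 := hset.hs1
  have hs0 := hset.hs0
  have hc1 : 2 * s - 1 ∈ Icc (-1 : ℝ) 0 := ⟨by linarith, by linarith⟩
  have hc2 : s - 1 ∈ Icc (-1 : ℝ) 0 := ⟨by linarith, by linarith⟩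
  have m0 : Measurable fun r : (Config d × (EucSp d × EucSp d)) × EucSp d => r.1.1 := by fun_prop
  have m1 : Measurable fun r : (Config d × (EucSp d × EucSp d)) × EucSp d => r.1.2.1 := by fun_prop
  have m2 : Measurable fun r : (Config d × (EucSp d × EucSp d)) × EucSp d => r.1.2.2 := by fun_prop
  have mi := measurable_ins (measurable_ins m0 m2) m1
  have hne : ∀ᵐ p : (EucSp d × EucSp d) × EucSp d ∂(volume.prod volume).prod volume,
      p.1.1 ≠ p.1.2 ∧ ε⁻¹ • p.2 + p.1.1 ≠ p.1.2 := by
    have hm1 : MeasurableSet {w : EucSp d × EucSp d | w.1 ≠ w.2} :=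
      (measurableSet_eq_fun measurable_fst measurable_snd).compl
    have hm : MeasurableSet {p : (EucSp d × EucSp d) × EucSp d |
        p.1.1 ≠ p.1.2 ∧ ε⁻¹ • p.2 + p.1.1 ≠ p.1.2} :=
      (measurableSet_eq_fun (by fun_prop) (by fun_prop)).compl.inter
        (measurableSet_eq_fun (by fun_prop) (by fun_prop)).compl
    have hd : ∀ᵐ w : EucSp d × EucSp d ∂volume.prod volume, w.1 ≠ w.2 :=
      (Measure.ae_prod_iff_ae_ae hm1).2 (ae_of_all _ fun x =>
        (Measure.ae_ne volume x).mono fun _ h => h.symm)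
    refine (Measure.ae_prod_iff_ae_ae hm).2 (hd.mono fun w hw => ?_)
    filter_upwards [Measure.ae_ne volume (ε • (w.2 - w.1))] with y hy
    refine ⟨hw, fun h => hy ?_⟩
    rw [← h, add_sub_cancel_right, smul_inv_smul₀ hε.ne']
  obtain ⟨h1, h2, h3⟩ := integral_prod_integral_eq (μ := μ)
    (ν := (volume : Measure (EucSp d)).prod (volume : Measure (EucSp d)))
    (Φ := fun q y => (papangelou₂ z φ q.1 q.2).toReal *
      (jumpWeight s φ f a ε (((q.1.ins q.2.2).ins q.2.1).del q.2.1) q.2.1 y *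
        deathWeight s φ f (((q.1.ins q.2.2).ins q.2.1).del q.2.2) q.2.2))
    (c := fun p => z * z * (Real.exp (f p.1.1) - 1) * (Real.exp (f p.1.2) - 1) *
      Real.exp (f p.1.1) * Real.exp (f p.1.2) * a p.2 *
        rexp (((2 * s - 1 : ℝ) : EReal) * φ (p.1.1 - p.1.2) +
          ((s - 1 : ℝ) : EReal) * φ (ε⁻¹ • p.2 + p.1.1 - p.1.2)))
    (b := fun p => |(Real.exp (f p.1.1) - 1) * Real.exp (f p.1.1)| *
      |(Real.exp (f p.1.2) - 1) * Real.exp (f p.1.2)| *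
        (z * z * Real.exp (2 * B + 2 * B) * a p.2))
    (e := fun p γ => rexp (((s - 1 : ℝ) : EReal) * energy φ p.1.1 γ.1 +
      ((s - 1 : ℝ) : EReal) * energy φ p.1.2 γ.1 +
      ((s - 1 : ℝ) : EReal) * energy φ (ε⁻¹ • p.2 + p.1.1) γ.1 + ((2 * cpair f γ : ℝ) : EReal)))
    (K := K)
    ((((measurable_papangelou₂ hset.pp.meas).comp measurable_fst).ennreal_toReal).mul
      ((measurable_jumpWeight hset.pp.meas hfm ha.meas ε (measurable_del mi m1) m1
        measurable_snd).mul (measurable_deathWeight hset.pp.meas hfm (measurable_del mi m2) m2)))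
    ((hf.integrable_exp_sub_one_mul_exp.abs.mul_prod hf.integrable_exp_sub_one_mul_exp.abs).mul_prod
      (ha.int.const_mul _))
    (hne.mono fun p hp => by
      have hr := rexp_phi_le hset.stable hset.hB hset.pp hc1 hc2 (sub_ne_zero.2 hp.1)
        (sub_ne_zero.2 hp.2)
      have hz := hset.hz.le
      have ha0 := ha.nonneg p.2
      rw [abs_mul _ (rexp _), abs_of_nonneg (rexp_nonneg _)]
      refine (mul_le_mul_of_nonneg_left hr (abs_nonneg _)).trans (le_of_eq ?_)
      simp only [abs_mul, abs_of_nonneg hz, abs_of_nonneg ha0, Real.abs_exp]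
      ring)
    (fun _ _ => rexp_nonneg _)
    (fun p => hK _ hc2 _ hc2 _ hc2 _ _ _)
    (hne.mono fun p hp => by
      filter_upwards [hset.ae_notMem_and_energy_ne_top p.1.1,
        hset.ae_notMem_and_energy_ne_top p.1.2,
        hset.ae_notMem_and_energy_ne_top (ε⁻¹ • p.2 + p.1.1)] with γ g1 g2 g3
      exact papangelou₂_mul_weights hset.hz.le hset.pp hf.2 hp.1 hp.2 g1.1 g2.1 g1.2 g2.2 g3.2)
  have hw : (fun p : Config d × (EucSp d × EucSp d) => (papangelou₂ z φ p.1 p.2).toReal *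
      weightProd s φ f a ε ((p.1.ins p.2.2).ins p.2.1, p.2)) = fun q => ∫ y,
        (papangelou₂ z φ q.1 q.2).toReal *
          (jumpWeight s φ f a ε (((q.1.ins q.2.2).ins q.2.1).del q.2.1) q.2.1 y *
            deathWeight s φ f (((q.1.ins q.2.2).ins q.2.1).del q.2.2) q.2.2) := by
    ext p
    rw [integral_const_mul, integral_mul_const, weightProd]
  rw [hw]
  exact ⟨h1, h3.trans ((integral_prod _ h2).trans (integral_prod _ h2.integral_prod_left))⟩

end Evaluation

/-- explicit formula for `∫_Γ (H_0^- F)(H_ε^- F) dμ` with `F = e^{⟨f,·⟩}`,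
`ε > 0`. -/
theorem statement17 (d : ℕ) (s z B ξ : ℝ) (φ : EucSp d → EReal) (μ : Measure (Config d))
    (k u : ∀ n : ℕ, (Fin n → EucSp d) → ℝ) (hset : Setting d s z B ξ φ μ k u)
    (a : EucSp d → ℝ) (ha : GoodA a)
    (f : EucSp d → ℝ) (hf : IsC0 f) (ε : ℝ) (hε : 0 < ε) :
    ∫ γ, H0Minus s φ (fun γ' => Real.exp (cpair f γ')) γ *
        HepsMinus s (aScaled a ε) φ (fun γ' => Real.exp (cpair f γ')) γ ∂μ
      = (∫ x : EucSp d, ∫ y : EucSp d,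
            z * (Real.exp (f x) - 1) ^ 2 * a y *
            ∫ γ, rexp (((2 * s - 1 : ℝ) : EReal) * energy φ x γ.1 +
              ((s - 1 : ℝ) : EReal) * energy φ (ε⁻¹ • y + x) γ.1 +
              ((2 * cpair f γ : ℝ) : EReal)) ∂μ)
        + ∫ x₁ : EucSp d, ∫ x₂ : EucSp d, ∫ y : EucSp d,
            z * z * (Real.exp (f x₁) - 1) * (Real.exp (f x₂) - 1) *
              Real.exp (f x₁) * Real.exp (f x₂) * a y *
              rexp (((2 * s - 1 : ℝ) : EReal) * φ (x₁ - x₂) +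
                ((s - 1 : ℝ) : EReal) * φ (ε⁻¹ • y + x₁ - x₂)) *
            ∫ γ, rexp (((s - 1 : ℝ) : EReal) * energy φ x₁ γ.1 +
              ((s - 1 : ℝ) : EReal) * energy φ x₂ γ.1 +
              ((s - 1 : ℝ) : EReal) * energy φ (ε⁻¹ • y + x₁) γ.1 +
              ((2 * cpair f γ : ℝ) : EReal)) ∂μ := by
  have := hset.prob
  obtain ⟨i₁, e₁⟩ := hset.integral_papangelou_mul_weightProd (ε := ε) ha hf
  obtain ⟨i₂, e₂⟩ := hset.integral_papangelou₂_mul_weightProd ha hf hε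
  obtain ⟨i, e⟩ := integral_pairMeasure_eq hset.gnz hset.pp.meas
    (measurable_weightProd hset.pp.meas hf.1.measurable ha.meas ε) i₁ i₂
  rw [e₁, e₂] at e
  rw [← e, pairMeasure, Measure.integral_compProd i]
  exact integral_congr_ae (ae_of_all _ (H0Minus_mul_HepsMinus hset.pp.meas hf ha hε))

end
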